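/- arXiv:1710.04797 — 4 statements merged into one kernel-verified Lean document; each statement's English description precedes it below -/
import Mathlib

section
/- Let m ≥ 2 be an even integer. Then the subgroup E_k of H_k generated by x_1^m z^{v_1 m/2}, …, x_{2n}^m z^{v_{2n} m/2}, z^m is a normal subgroup of H_k, and it is invariant under both automorphisms t and b: t(E_k) = E_k and b(E_k) = E_k. -/
/-- The discrete Heisenberg group `H_k` (`k = 2n+1`), realized concretely on
`(Fin n → ℤ) × (Fin n → ℤ) × ℤ`. -/
@[ext]
structure Heis (n : ℕ) where
  a : Fin n → ℤ
  b : Fin n → ℤ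
  c : ℤ

namespace Heis

variable {n : ℕ}

instance : Mul (Heis n) :=
  ⟨fun g h => ⟨g.a + h.a, g.b + h.b, g.c + h.c + ∑ i, g.a i * h.b i⟩⟩

instance : One (Heis n) := ⟨⟨0, 0, 0⟩⟩

instance : Inv (Heis n) :=
  ⟨fun g => ⟨-g.a, -g.b, -g.c + ∑ i, g.a i * g.b i⟩⟩

@[simp] lemma mul_a (g h : Heis n) : (g * h).a = g.a + h.a := rfl
@[simp] lemma mul_b (g h : Heis n) : (g * h).b = g.b + h.b := rfl
@[simp] lemma mul_c (g h : Heis n) :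
    (g * h).c = g.c + h.c + ∑ i, g.a i * h.b i := rfl
@[simp] lemma one_a : (1 : Heis n).a = 0 := rfl
@[simp] lemma one_b : (1 : Heis n).b = 0 := rfl
@[simp] lemma one_c : (1 : Heis n).c = 0 := rfl
@[simp] lemma inv_a (g : Heis n) : g⁻¹.a = -g.a := rfl
@[simp] lemma inv_b (g : Heis n) : g⁻¹.b = -g.b := rfl
@[simp] lemma inv_c (g : Heis n) : g⁻¹.c = -g.c + ∑ i, g.a i * g.b i := rfl

instance : Group (Heis n) where
  mul_assoc g h k := by
    ext <;> simp [Finset.sum_add_distrib, add_mul, mul_add] <;> ring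
  one_mul g := by ext <;> simp
  mul_one g := by ext <;> simp
  inv_mul_cancel g := by
    ext <;> simp [Finset.sum_add_distrib, neg_mul] <;> ring

end Heis

/-- The generators `x_1, …, x_{2n}` of the Heisenberg group: for `1 ≤ i ≤ n`,
`x_i = (e_i, 0, 0)`; for `n+1 ≤ i ≤ 2n`, `x_i = (0, e_{i-n}, 0)`. -/
def xg (n : ℕ) (i : ℕ) : Heis n :=
  if h : 1 ≤ i ∧ i ≤ n then ⟨Pi.single (⟨i - 1, by omega⟩ : Fin n) 1, 0, 0⟩
  else if h' : n + 1 ≤ i ∧ i ≤ 2 * n then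
    ⟨0, Pi.single (⟨i - n - 1, by omega⟩ : Fin n) 1, 0⟩
  else 1

/-- The central element `z = (0,0,1)`. -/
def zz (n : ℕ) : Heis n := ⟨0, 0, 1⟩

/-- The automorphism `t : (a,b,c) ↦ (-a,-b,c)` of the Heisenberg group. -/
def tAut (n : ℕ) : MulAut (Heis n) where
  toFun g := ⟨-g.a, -g.b, g.c⟩
  invFun g := ⟨-g.a, -g.b, g.c⟩
  left_inv g := by ext <;> simp
  right_inv g := by ext <;> simp
  map_mul' g h := by ext <;> simp <;> ring

/-- The subgroup `⟨t⟩` of `Aut(H_k)` generated by `t`. -/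
abbrev tsub (n : ℕ) : Subgroup (MulAut (Heis n)) := Subgroup.zpowers (tAut n)

/-- The group `R_k = H_k ⋊ ⟨t⟩`. -/
abbrev RR (n : ℕ) := SemidirectProduct (Heis n) (tsub n) (tsub n).subtype

/-- The element `t` of `R_k`. -/
def tR (n : ℕ) : RR n := SemidirectProduct.inr ⟨tAut n, Subgroup.mem_zpowers _⟩

/-- The defining conditions for the automorphism `b` of `H_k`. -/
def IsB (n : ℕ) (b : MulAut (Heis n)) : Prop :=
  (∀ i : ℕ, 1 ≤ i → i ≤ n - 1 → b (xg n i) = xg n (i + 1) * xg n (n + 1)) ∧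
  (∀ i : ℕ, n ≤ i → i ≤ 2 * n - 1 → b (xg n i) = xg n (i + 1)) ∧
  b (xg n (2 * n)) =
    (xg n 1)⁻¹ * ((List.range n).map fun j => (xg n (n + 1 + j))⁻¹).prod

/-- The defining conditions for the automorphism `B` of `R_k` extending `b`. -/
def IsBR (n : ℕ) (b : MulAut (Heis n)) (B : MulAut (RR n)) : Prop :=
  (∀ h : Heis n, B (SemidirectProduct.inl h) = SemidirectProduct.inl (b h)) ∧
  B (tR n) = SemidirectProduct.inl (xg n (n + 1)) * tR n

/-- The coefficients `v_1, …, v_{2n}`: `v_i = 1` for `n ≤ i ≤ 2n`, and for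
`1 ≤ i ≤ n-1`, `v_i = 1` if `n - i` is even and `v_i = 0` if `n - i` is odd. -/
def vcoef (n i : ℕ) : ℕ :=
  if n ≤ i then 1 else if (n - i) % 2 = 0 then 1 else 0

/-- The generating set `{x_1^m z^{v_1 m/2}, …, x_{2n}^m z^{v_{2n} m/2}, z^m}`
of the subgroup `E_k`. -/
def Egen (n m : ℕ) : Set (Heis n) :=
  {g | (∃ i : ℕ, 1 ≤ i ∧ i ≤ 2 * n ∧
      g = xg n i ^ m * zz n ^ (vcoef n i * (m / 2))) ∨ g = zz n ^ m}

/-- The subgroup `E_k = ⟨x_1^m z^{v_1 m/2}, …, x_{2n}^m z^{v_{2n} m/2}, z^m⟩`. -/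
def Esub (n m : ℕ) : Subgroup (Heis n) := Subgroup.closure (Egen n m)

namespace HeisAux

lemma pow_a {n : ℕ} (g : Heis n) (k : ℕ) : (g ^ k).a = fun i => (k : ℤ) * g.a i := by
  induction k with
  | zero => ext i; simp
  | succ k ih => rw [pow_succ]; ext i; simp [ih]; ring

lemma pow_b {n : ℕ} (g : Heis n) (k : ℕ) : (g ^ k).b = fun i => (k : ℤ) * g.b i := by
  induction k with
  | zero => ext i; simp
  | succ k ih => rw [pow_succ]; ext i; simp [ih]; ring

lemma pow_c {n : ℕ} (g : Heis n) (k : ℕ) :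
    2 * (g ^ k).c = 2 * k * g.c + k * (k - 1) * ∑ i, g.a i * g.b i := by
  induction k with
  | zero => simp
  | succ k ih =>
    rw [pow_succ, Heis.mul_c, pow_a]
    simp only [mul_assoc, ← Finset.mul_sum] at ih ⊢
    push_cast
    linear_combination ih

lemma zz_pow (n k : ℕ) : zz n ^ k = ⟨0, 0, k⟩ := by
  ext i
  · simp [pow_a, zz]
  · simp [pow_b, zz]
  · have := pow_c (zz n) k
    simp [zz] at this ⊢
    linarith

/-- linear form -/
def L {n : ℕ} (p q : Fin n → ℤ) : ℤ := ∑ i : Fin n, (vcoef n (i + 1) : ℤ) * p i + ∑ i, q i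

def P (n r : ℕ) (g : Heis n) : Prop :=
  ∃ (p q : Fin n → ℤ) (s : ℤ), g.a = (fun i => 2 * r * p i) ∧ g.b = (fun i => 2 * r * q i) ∧
    g.c = r * L p q + 2 * r * s

lemma L_add {n : ℕ} (p q p' q' : Fin n → ℤ) : L (p + p') (q + q') = L p q + L p' q' := by
  simp [L, mul_add, Finset.sum_add_distrib]; ring

lemma L_neg {n : ℕ} (p q : Fin n → ℤ) : L (-p) (-q) = - L p q := by
  simp [L]; ring

/-- explicit form of the subgroup -/
def E' (n r : ℕ) : Subgroup (Heis n) where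
  carrier := {g | P n r g}
  mul_mem' := by
    rintro g h ⟨p, q, s, h1, h2, h3⟩ ⟨p', q', s', h1', h2', h3'⟩
    refine ⟨p + p', q + q', s + s' + 2 * r * ∑ i, p i * q' i, ?_, ?_, ?_⟩
    · ext i; simp [h1, h1']; ring
    · ext i; simp [h2, h2']; ring
    · rw [L_add, Heis.mul_c, h3, h3', h1, h2']
      have : ∑ i, (2 * r * p i) * (2 * r * q' i) = 2 * r * (2 * r) * ∑ i, p i * q' i := by
        rw [Finset.mul_sum]; exact Finset.sum_congr rfl fun i _ => by ring
      rw [this]; ring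
  one_mem' := ⟨0, 0, 0, by ext; simp, by ext; simp, by simp [L]⟩
  inv_mem' := by
    rintro g ⟨p, q, s, h1, h2, h3⟩
    refine ⟨-p, -q, -s + 2 * r * ∑ i, p i * q i, ?_, ?_, ?_⟩
    · ext i; simp [h1]
    · ext i; simp [h2]
    · rw [L_neg, Heis.inv_c, h3, h1, h2]
      have : ∑ i, (2 * r * p i) * (2 * r * q i) = 2 * r * (2 * r) * ∑ i, p i * q i := by
        rw [Finset.mul_sum]; exact Finset.sum_congr rfl fun i _ => by ring
      rw [this]; ring

lemma mem_E' {n r : ℕ} {g : Heis n} : g ∈ E' n r ↔ P n r g := Iff.rfl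

lemma xg_lo {n : ℕ} (i : Fin n) : xg n (i + 1) = ⟨Pi.single i 1, 0, 0⟩ := by
  have h := i.2
  unfold xg
  rw [dif_pos (by omega)]
  rfl

lemma xg_hi {n : ℕ} (i : Fin n) : xg n (n + 1 + i) = ⟨0, Pi.single i 1, 0⟩ := by
  have h := i.2
  unfold xg
  rw [dif_neg (by omega), dif_pos (by omega)]
  have : (⟨n + 1 + i - n - 1, by omega⟩ : Fin n) = i := by ext; simp; omega
  rw [this]

lemma cases_idx {n i : ℕ} (h1 : 1 ≤ i) (h2 : i ≤ 2 * n) :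
    (∃ j : Fin n, i = j + 1) ∨ (∃ j : Fin n, i = n + 1 + j) := by
  by_cases h : i ≤ n
  · exact Or.inl ⟨⟨i - 1, by omega⟩, by simp; omega⟩
  · exact Or.inr ⟨⟨i - n - 1, by omega⟩, by simp; omega⟩

lemma vhi {n : ℕ} (i : Fin n) : vcoef n (n + 1 + i) = 1 := by
  unfold vcoef; rw [if_pos (by omega)]

lemma gen_lo {n r : ℕ} (i : Fin n) (k : ℕ) : xg n (i + 1) ^ (2 * r) * zz n ^ k
    = ⟨fun j => 2 * r * (Pi.single i 1 : Fin n → ℤ) j, 0, k⟩ := by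
  have := pow_c (xg n (i + 1)) (2 * r)
  rw [zz_pow]
  ext j
  · simp [pow_a, xg_lo]
  · simp [pow_b, xg_lo]
  · simp [xg_lo] at this ⊢
    exact this

lemma gen_hi {n r : ℕ} (i : Fin n) (k : ℕ) : xg n (n + 1 + i) ^ (2 * r) * zz n ^ k
    = ⟨0, fun j => 2 * r * (Pi.single i 1 : Fin n → ℤ) j, k⟩ := by
  have := pow_c (xg n (n + 1 + i)) (2 * r)
  rw [zz_pow]
  ext j
  · simp [pow_a, xg_hi]
  · simp [pow_b, xg_hi]
  · simp [xg_hi] at this ⊢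
    exact this

lemma addsub_top {n : ℕ} (S : AddSubgroup (Fin n → ℤ)) (h : ∀ i, Pi.single i 1 ∈ S)
    (p : Fin n → ℤ) : p ∈ S := by
  have : p = ∑ i, p i • (Pi.single i 1 : Fin n → ℤ) := by
    ext j
    simp [Finset.sum_apply, Pi.single_apply]
  rw [this]
  exact S.sum_mem fun i _ => S.zsmul_mem (h i) _

lemma closure_eq (n r : ℕ) : Esub n (2 * r) = E' n r := by
  have hr : 2 * r / 2 = r := by omega
  apply le_antisymm
  · refine (Subgroup.closure_le _).2 ?_
    rintro g (⟨i, h1, h2, rfl⟩ | rfl)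
    · rw [hr]
      rcases cases_idx h1 h2 with ⟨j, rfl⟩ | ⟨j, rfl⟩
      · rw [gen_lo]
        refine ⟨Pi.single j 1, 0, 0, rfl, by ext; simp, ?_⟩
        simp [L, Pi.single_apply, mul_comm]
      · rw [gen_hi, vhi]
        refine ⟨0, Pi.single j 1, 0, by ext; simp, rfl, ?_⟩
        simp [L]
    · rw [zz_pow]
      exact ⟨0, 0, 1, by ext; simp, by ext; simp, by simp [L]⟩
  · have hz : (⟨0, 0, 2 * r⟩ : Heis n) ∈ Esub n (2 * r) := by
      have : zz n ^ (2 * r) ∈ Esub n (2 * r) := Subgroup.subset_closure (Or.inr rfl)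
      rw [zz_pow] at this
      exact_mod_cast this
    have hz' : ∀ s : ℤ, (⟨0, 0, 2 * r * s⟩ : Heis n) ∈ Esub n (2 * r) := by
      let S : AddSubgroup ℤ :=
        { carrier := {s | (⟨0, 0, 2 * r * s⟩ : Heis n) ∈ Esub n (2 * r)}
          zero_mem' := by
            have := (Esub n (2 * r)).one_mem
            simp only [Set.mem_ofPred_eq, mul_zero]; exact this
          add_mem' := by
            intro x y hx hy
            have := (Esub n (2 * r)).mul_mem hx hy
            simp only [Set.mem_ofPred_eq]
            convert this using 1
            ext <;> simp [mul_add]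
          neg_mem' := by
            intro x hx
            have := (Esub n (2 * r)).inv_mem hx
            simp only [Set.mem_ofPred_eq]
            convert this using 1
            ext <;> simp }
      intro s
      have h1 : (1 : ℤ) ∈ S := by
        change (⟨0, 0, 2 * r * 1⟩ : Heis n) ∈ Esub n (2 * r)
        simpa using hz
      have := S.zsmul_mem h1 s
      simp only [smul_eq_mul, mul_one] at this
      exact this
    have hp : ∀ p : Fin n → ℤ, (⟨fun i => 2 * r * p i, 0, r * L p 0⟩ : Heis n)
        ∈ Esub n (2 * r) := by
      let S : AddSubgroup (Fin n → ℤ) :=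
        { carrier := {p | (⟨fun i => 2 * r * p i, 0, r * L p 0⟩ : Heis n) ∈ Esub n (2 * r)}
          zero_mem' := by
            have := (Esub n (2 * r)).one_mem
            simp only [Set.mem_ofPred_eq]
            convert this using 1
            ext <;> simp [L]
          add_mem' := by
            intro x y hx hy
            have := (Esub n (2 * r)).mul_mem hx hy
            simp only [Set.mem_ofPred_eq]
            convert this using 1
            ext <;> simp [mul_add, L, Finset.sum_add_distrib]
          neg_mem' := by
            intro x hx
            have := (Esub n (2 * r)).inv_mem hx
            simp only [Set.mem_ofPred_eq]
            convert this using 1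
            ext <;> simp [L] }
      refine addsub_top S fun i => ?_
      have : xg n (i + 1) ^ (2 * r) * zz n ^ (vcoef n (i + 1) * (2 * r / 2)) ∈ Esub n (2 * r) :=
        Subgroup.subset_closure (Or.inl ⟨i + 1, by omega, by omega, rfl⟩)
      rw [hr, gen_lo] at this
      change (⟨fun j => 2 * r * (Pi.single i 1 : Fin n → ℤ) j, 0, r * L (Pi.single i 1) 0⟩ : Heis n) ∈ Esub n (2 * r)
      convert this using 2
      simp [L, Pi.single_apply, mul_comm]
    have hq : ∀ p : Fin n → ℤ, (⟨0, fun i => 2 * r * p i, r * L 0 p⟩ : Heis n)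
        ∈ Esub n (2 * r) := by
      let S : AddSubgroup (Fin n → ℤ) :=
        { carrier := {p | (⟨0, fun i => 2 * r * p i, r * L 0 p⟩ : Heis n) ∈ Esub n (2 * r)}
          zero_mem' := by
            have := (Esub n (2 * r)).one_mem
            simp only [Set.mem_ofPred_eq]
            convert this using 1
            ext <;> simp [L]
          add_mem' := by
            intro x y hx hy
            have := (Esub n (2 * r)).mul_mem hx hy
            simp only [Set.mem_ofPred_eq]
            convert this using 1
            ext <;> simp [mul_add, L, Finset.sum_add_distrib]
          neg_mem' := by
            intro x hx
            have := (Esub n (2 * r)).inv_mem hx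
            simp only [Set.mem_ofPred_eq]
            convert this using 1
            ext <;> simp [L] }
      refine addsub_top S fun i => ?_
      have : xg n (n + 1 + i) ^ (2 * r) * zz n ^ (vcoef n (n + 1 + i) * (2 * r / 2))
          ∈ Esub n (2 * r) :=
        Subgroup.subset_closure (Or.inl ⟨n + 1 + i, by omega, by omega, rfl⟩)
      rw [hr, gen_hi, vhi] at this
      change (⟨0, fun j => 2 * r * (Pi.single i 1 : Fin n → ℤ) j, r * L 0 (Pi.single i 1)⟩ : Heis n) ∈ Esub n (2 * r)
      convert this using 2
      simp [L]
    rintro g ⟨p, q, s, h1, h2, h3⟩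
    have := (Esub n (2 * r)).mul_mem (hq q) ((Esub n (2 * r)).mul_mem (hp p) (hz' s))
    convert this using 1
    ext i
    · simp [h1]
    · simp [h2]
    · simp [h3, L]; ring

lemma normal_E' (n r : ℕ) : (E' n r).Normal := by
  constructor
  rintro g ⟨p, q, s, h1, h2, h3⟩ h
  refine ⟨p, q, s + ∑ i, h.a i * q i - ∑ i, p i * h.b i, ?_, ?_, ?_⟩
  · ext i; simp [h1]
  · ext i; simp [h2]
  · simp only [Heis.mul_c, Heis.inv_c, Heis.mul_a, Heis.inv_b, h1, h2, h3, Pi.add_apply,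
      Pi.neg_apply]
    have e1 : ∑ i, h.a i * (2 * r * q i) = 2 * r * ∑ i, h.a i * q i := by
      rw [Finset.mul_sum]; exact Finset.sum_congr rfl fun i _ => by ring
    have e2 : ∑ i, (h.a i + 2 * r * p i) * (-h.b i)
        = - ∑ i, h.a i * h.b i - 2 * r * ∑ i, p i * h.b i := by
      rw [Finset.mul_sum, ← Finset.sum_neg_distrib, ← Finset.sum_sub_distrib]
      exact Finset.sum_congr rfl fun i _ => by ring
    rw [e1, e2]; ring

lemma index_ne_zero (n r : ℕ) (hr : r ≠ 0) : (E' n r).index ≠ 0 := by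
  have : NeZero (4 * r) := ⟨by omega⟩
  let φ : Heis n → (Fin n → ZMod (4 * r)) × (Fin n → ZMod (4 * r)) × ZMod (4 * r) :=
    fun g => (fun i => (g.a i : ZMod (4 * r)), fun i => (g.b i : ZMod (4 * r)), (g.c : ZMod (4 * r)))
  have key : ∀ g h, φ g = φ h → g⁻¹ * h ∈ E' n r := by
    intro g h e
    simp only [φ, Prod.mk.injEq, funext_iff, ZMod.intCast_eq_intCast_iff_dvd_sub] at e
    obtain ⟨ea, eb, ec⟩ := e
    choose x hx using ea
    choose y hy using eb
    obtain ⟨w, hw⟩ := ec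
    push_cast at hx hy hw
    refine ⟨fun i => 2 * x i, fun i => 2 * y i,
      2 * w - (∑ i : Fin n, (vcoef n (i + 1) : ℤ) * x i + ∑ i, y i) - 2 * ∑ i, g.a i * y i, ?_, ?_, ?_⟩
    · ext i; simp; linarith [hx i]
    · ext i; simp; linarith [hy i]
    · simp only [Heis.mul_c, Heis.inv_c, Heis.inv_a, Pi.neg_apply, L]
      have hh : ∀ i, h.b i = g.b i + 4 * r * y i := fun i => by linarith [hy i]
      have e1 : ∑ i, -g.a i * h.b i = - ∑ i, g.a i * g.b i - 4 * r * ∑ i, g.a i * y i := by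
        rw [Finset.mul_sum, ← Finset.sum_neg_distrib, ← Finset.sum_sub_distrib]
        exact Finset.sum_congr rfl fun i _ => by rw [hh]; ring
      have e2 : ∑ i : Fin n, (vcoef n (i + 1) : ℤ) * (2 * x i)
          = 2 * ∑ i : Fin n, (vcoef n (i + 1) : ℤ) * x i := by
        rw [Finset.mul_sum]; exact Finset.sum_congr rfl fun i _ => by ring
      rw [e1, e2, ← Finset.mul_sum]
      linear_combination hw
  have : Finite (Heis n ⧸ E' n r) := by
    refine Finite.of_injective (fun x : Heis n ⧸ E' n r => φ x.out) ?_
    intro x y e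
    have := QuotientGroup.eq.2 (key _ _ e)
    simpa using this
  have : (E' n r).FiniteIndex := Subgroup.finiteIndex_of_finite_quotient
  exact Subgroup.FiniteIndex.index_ne_zero

lemma map_eq (n r : ℕ) (hr : r ≠ 0) (f : MulAut (Heis n))
    (h : Subgroup.map f.toMonoidHom (E' n r) ≤ E' n r) :
    Subgroup.map f.toMonoidHom (E' n r) = E' n r := by
  apply le_antisymm h
  have h1 := Subgroup.relIndex_mul_index h
  have h2 : (Subgroup.map f.toMonoidHom (E' n r)).index = (E' n r).index :=
    Subgroup.index_map_equiv (E' n r) f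
  rw [h2] at h1
  have h3 := index_ne_zero n r hr
  have : (Subgroup.map f.toMonoidHom (E' n r)).relIndex (E' n r) = 1 := by
    apply Nat.eq_of_mul_eq_mul_right (Nat.pos_of_ne_zero h3)
    rw [h1, one_mul]
  exact Subgroup.relIndex_eq_one.1 this

lemma t_le (n r : ℕ) : Subgroup.map (tAut n).toMonoidHom (E' n r) ≤ E' n r := by
  rintro _ ⟨g, ⟨p, q, s, h1, h2, h3⟩, rfl⟩
  refine ⟨-p, -q, s + L p q, ?_, ?_, ?_⟩
  · change -g.a = _
    ext i; simp [h1]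
  · change -g.b = _
    ext i; simp [h2]
  · change g.c = _
    rw [L_neg, h3]; ring

lemma list_prod (n k : ℕ) (hk : k ≤ n) :
    ((List.range k).map fun j => (xg n (n + 1 + j))⁻¹).prod
      = ⟨0, fun i => if (i : ℕ) < k then -1 else 0, 0⟩ := by
  induction k with
  | zero => simp; rfl
  | succ k ih =>
    rw [List.range_succ, List.map_append, List.prod_append, ih (by omega)]
    have := xg_hi (⟨k, by omega⟩ : Fin n)
    simp only at this
    simp only [List.map_cons, List.map_nil, List.prod_cons, List.prod_nil, mul_one, this]
    ext i
    · simp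
    · simp only [Heis.mul_b, Heis.inv_b, Pi.add_apply, Pi.neg_apply, Pi.single_apply, Fin.ext_iff]
      split_ifs <;> first | omega | rfl
    · simp

lemma pow_mem (n r : ℕ) (g : Heis n) (k s : ℤ)
    (h : 2 * r * g.c + r * (2 * r - 1) * ∑ i, g.a i * g.b i + k = r * L g.a g.b + 2 * r * s) :
    g ^ (2 * r) * ⟨0, 0, k⟩ ∈ E' n r := by
  refine ⟨g.a, g.b, s, ?_, ?_, ?_⟩
  · ext i; simp [pow_a]
  · ext i; simp [pow_b]
  · have := pow_c g (2 * r)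
    push_cast at this
    simp
    linarith

lemma b_zz (n : ℕ) (hn : 1 ≤ n) (b : MulAut (Heis n)) (hb : IsB n b) : b (zz n) = zz n := by
  obtain ⟨-, hb2, hb3⟩ := hb
  rw [list_prod n n le_rfl] at hb3
  have hb2 := hb2 n le_rfl (by omega)
  obtain ⟨l, hl⟩ : ∃ l : Fin n, (l : ℕ) = n - 1 := ⟨⟨n - 1, by omega⟩, rfl⟩
  obtain ⟨o, ho⟩ : ∃ o : Fin n, (o : ℕ) = 0 := ⟨⟨0, by omega⟩, rfl⟩
  have x1 := xg_lo l
  have x2 := xg_hi l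
  have x3 := xg_lo o
  have x4 := xg_hi o
  rw [show (l : ℕ) + 1 = n by omega] at x1
  rw [show n + 1 + (l : ℕ) = 2 * n by omega] at x2
  rw [ho] at x3 x4
  simp only [zero_add, add_zero] at x3 x4
  have hz : zz n * (xg n (2 * n) * xg n n) = xg n n * xg n (2 * n) := by
    rw [x1, x2]
    ext i <;> simp [zz, add_comm, Pi.single_apply]
  have h := congrArg b hz
  rw [map_mul, map_mul, map_mul, hb2, hb3, x3, x4] at h
  rw [← mul_left_inj, h]
  ext i
  · simp [zz]
  · simp [zz, add_comm]
  · simp [zz, Pi.single_apply]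

lemma v_step {n i : ℕ} (h : i + 1 ≤ n) : ∃ s : ℤ, (vcoef n i : ℤ) = vcoef n (i + 1) + 1 + 2 * s := by
  unfold vcoef
  by_cases h1 : n ≤ i + 1
  · refine ⟨-1, ?_⟩
    rw [if_neg (by omega), if_neg (by omega), if_pos h1]; norm_num
  · rw [if_neg (by omega), if_neg h1]
    by_cases h2 : (n - i) % 2 = 0
    · exact ⟨0, by rw [if_pos h2, if_neg (by omega)]; norm_num⟩
    · exact ⟨-1, by rw [if_neg h2, if_pos (by omega)]; norm_num⟩

lemma v_one (n : ℕ) (hn : 1 ≤ n) : ∃ s : ℤ, (vcoef n 1 : ℤ) + n = 2 * s := by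
  unfold vcoef
  by_cases h1 : n ≤ 1
  · exact ⟨1, by rw [if_pos h1]; push_cast; omega⟩
  · rw [if_neg h1]
    by_cases h2 : (n - 1) % 2 = 0
    · exact ⟨(n + 1) / 2, by rw [if_pos h2]; push_cast; omega⟩
    · exact ⟨n / 2, by rw [if_neg h2]; push_cast; omega⟩

lemma b_le (n r : ℕ) (hn : 1 ≤ n) (b : MulAut (Heis n)) (hb : IsB n b) :
    Subgroup.map b.toMonoidHom (E' n r) ≤ E' n r := by
  have hr : 2 * r / 2 = r := by omega
  rw [← closure_eq, Subgroup.map_le_iff_le_comap]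
  conv_lhs => unfold Esub
  rw [Subgroup.closure_le]
  have bz := b_zz n hn b hb
  obtain ⟨hb1, hb2, hb3⟩ := hb
  rw [list_prod n n le_rfl] at hb3
  rintro g (⟨i, h1, h2, rfl⟩ | rfl)
  · change b _ ∈ Esub n (2 * r)
    rw [map_mul, map_pow, map_pow, bz, closure_eq, hr, zz_pow]
    by_cases c1 : i ≤ n - 1
    · rw [hb1 i h1 c1]
      have x1 := xg_lo (⟨i, by omega⟩ : Fin n)
      have x2 := xg_hi (⟨0, by omega⟩ : Fin n)
      simp only [add_zero] at x1 x2
      rw [x1, x2]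
      obtain ⟨s, hs⟩ := v_step (n := n) (i := i) (by omega)
      refine pow_mem n r _ _ s ?_
      have hne : i ≠ 0 := by omega
      simp [L, Pi.single_apply, hne, hne.symm, hs]
      ring
    · by_cases c2 : i ≤ 2 * n - 1
      · rw [hb2 i (by omega) c2]
        have x2 := xg_hi (⟨i - n, by omega⟩ : Fin n)
        simp only at x2
        rw [show n + 1 + (i - n) = i + 1 by omega] at x2
        rw [x2]
        refine pow_mem n r _ _ 0 ?_
        have : vcoef n i = 1 := by unfold vcoef; rw [if_pos (by omega)]
        simp [L, this]
      · obtain rfl : i = 2 * n := by omega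
        rw [hb3]
        have x1 := xg_lo (⟨0, by omega⟩ : Fin n)
        simp only [zero_add] at x1
        rw [x1]
        obtain ⟨s, hs⟩ := v_one n hn
        have : vcoef n (2 * n) = 1 := by unfold vcoef; rw [if_pos (by omega)]
        refine pow_mem n r _ _ (1 + r + s) ?_
        simp [L, this, Pi.single_apply]
        linear_combination r * hs
  · change b _ ∈ Esub n (2 * r)
    rw [map_pow, bz]
    exact Subgroup.subset_closure (Or.inr rfl)

end HeisAux

/-- For even `m ≥ 2`, the subgroup `E_k` is a normal subgroup of `H_k` and is
invariant under both automorphisms `t` and `b`. -/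
theorem Esub_properties (n m : ℕ) (hn : 1 ≤ n) (hm : 2 ≤ m) (hme : Even m)
    (b : MulAut (Heis n)) (hb : IsB n b) :
    (Esub n m).Normal ∧
    Subgroup.map (tAut n).toMonoidHom (Esub n m) = Esub n m ∧
    Subgroup.map b.toMonoidHom (Esub n m) = Esub n m := by
  obtain ⟨r, rfl⟩ := hme
  rw [← two_mul, HeisAux.closure_eq]
  exact ⟨HeisAux.normal_E' n r, HeisAux.map_eq n r (by omega) _ (HeisAux.t_le n r),
    HeisAux.map_eq n r (by omega) _ (HeisAux.b_le n r hn b hb)⟩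
end

section
/- Let m ≥ 2 be an even integer and assume k = 2n+1 is prime. In the quotient group H_k/E_k: the element x_{n+1}E_k has order 2m; the group H_k/E_k has order m^k; the images {sE_k : s ∈ P_k} give a connected Cayley digraph on H_k/E_k (arc set {(g, sg) : g ∈ H_k/E_k, s ∈ P_k E_k/E_k}) which is an oriented digraph of out-valency k; this digraph admits a group of automorphisms acting transitively on its vertices and on its arcs (namely the group generated by right translations by H_k/E_k and the automorphism induced by b); and the cosets of the image of ⟨z⟩ in H_k/E_k form a system of blocks of imprimitivity of size m for this group. -/
/-- The arc relation of the Cayley digraph on `H_k/E` with connection set the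
image of `P_k = {b^j(x_{n+1}) : 0 ≤ j ≤ k-1}`: `(g, s·g)` for `s` in the image
of `P_k`. -/
def PArc (n k : ℕ) (b : MulAut (Heis n)) (E : Subgroup (Heis n)) [E.Normal]
    (g h : Heis n ⧸ E) : Prop :=
  ∃ j < k, h = (QuotientGroup.mk ((b ^ j) (xg n (n + 1))) : Heis n ⧸ E) * g

/-- The group of permutations of `H_k/E` generated by right translations
together with the automorphism induced by `b`. -/
def CayGrp (n : ℕ) (b : MulAut (Heis n)) (E : Subgroup (Heis n)) [E.Normal]
    (hbE : Subgroup.map (b : Heis n →* Heis n) E = E) :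
    Subgroup (Equiv.Perm (Heis n ⧸ E)) :=
  Subgroup.closure
    (Set.range (fun h : Heis n ⧸ E => Equiv.mulRight h) ∪
      {(QuotientGroup.congr E E (b : Heis n ≃* Heis n) hbE).toEquiv})

/-- The coset of the image of `⟨z⟩` in `H_k/E` containing `g`. -/
def zCoset (n : ℕ) (E : Subgroup (Heis n)) [E.Normal] (g : Heis n ⧸ E) :
    Set (Heis n ⧸ E) :=
  {q | ∃ c : ℤ, q = (QuotientGroup.mk (zz n ^ c) : Heis n ⧸ E) * g}

lemma hp_a {n : ℕ} (a : Fin n → ℤ) (j : ℕ) :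
    (⟨a, 0, 0⟩ : Heis n) ^ j = ⟨(j : ℤ) • a, 0, 0⟩ := by
  induction j with
  | zero => ext <;> simp
  | succ j ih => rw [pow_succ, ih]; ext <;> simp <;> ring

lemma hp_b {n : ℕ} (a : Fin n → ℤ) (j : ℕ) :
    (⟨0, a, 0⟩ : Heis n) ^ j = ⟨0, (j : ℤ) • a, 0⟩ := by
  induction j with
  | zero => ext <;> simp
  | succ j ih => rw [pow_succ, ih]; ext <;> simp <;> ring

lemma hp_z {n : ℕ} (j : ℕ) : zz n ^ j = ⟨0, 0, (j : ℤ)⟩ := by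
  induction j with
  | zero => ext <;> simp
  | succ j ih => rw [pow_succ, ih]; ext <;> simp [zz]

lemma hp_zz {n : ℕ} (j : ℤ) : zz n ^ j = ⟨0, 0, j⟩ := by
  cases j with
  | ofNat j => simpa using hp_z j
  | negSucc j => rw [zpow_negSucc, hp_z]; ext <;> simp; omega

lemma xg_lo {n : ℕ} (i : Fin n) : xg n (i + 1) = ⟨Pi.single i 1, 0, 0⟩ := by
  have := i.2
  unfold xg
  rw [dif_pos ⟨by omega, by omega⟩]
  simp

lemma xg_hi {n : ℕ} (i : Fin n) : xg n (n + 1 + i) = ⟨0, Pi.single i 1, 0⟩ := by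
  have := i.2
  unfold xg
  rw [dif_neg (by omega), dif_pos ⟨by omega, by omega⟩]
  have : (⟨n + 1 + (i : ℕ) - n - 1, by omega⟩ : Fin n) = i := by ext; simp; omega
  rw [this]

lemma xg_cases {n : ℕ} (i : ℕ) (h1 : 1 ≤ i) (h2 : i ≤ 2 * n) :
    (∃ j : Fin n, i = j + 1) ∨ (∃ j : Fin n, i = n + 1 + j) := by
  by_cases h : i ≤ n
  · left; exact ⟨⟨i - 1, by omega⟩, by simp; omega⟩
  · right; exact ⟨⟨i - n - 1, by omega⟩, by simp; omega⟩

/-- Linear form. -/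
def lf (n : ℕ) (A B : Fin n → ℤ) : ℤ := ∑ i : Fin n, (vcoef n (i + 1) : ℤ) * A i + ∑ i, B i

lemma lf_add {n : ℕ} (A B A' B' : Fin n → ℤ) :
    lf n (A + A') (B + B') = lf n A B + lf n A' B' := by
  simp [lf, mul_add, Finset.sum_add_distrib]; ring

lemma lf_neg {n : ℕ} (A B : Fin n → ℤ) : lf n (-A) (-B) = - lf n A B := by
  simp [lf]; ring

def FF (n m : ℕ) : Subgroup (Heis n) where
  carrier := {g | ∃ A B : Fin n → ℤ, g.a = (m : ℤ) • A ∧ g.b = (m : ℤ) • B ∧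
    (m : ℤ) ∣ g.c - ((m / 2 : ℕ) : ℤ) * lf n A B}
  one_mem' := ⟨0, 0, by simp, by simp, by simp [lf]⟩
  mul_mem' := by
    rintro g h ⟨A, B, ha, hb, hc⟩ ⟨A', B', ha', hb', hc'⟩
    refine ⟨A + A', B + B', by simp [ha, ha'], by simp [hb, hb'], ?_⟩
    rw [lf_add]
    have : (m : ℤ) ∣ ∑ i, g.a i * h.b i := by
      apply Finset.dvd_sum
      intro i _
      rw [ha]
      exact Dvd.dvd.mul_right ⟨A i, by simp⟩ _
    have := dvd_add (dvd_add hc hc') this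
    have e : (g * h).c - ((m / 2 : ℕ) : ℤ) * (lf n A B + lf n A' B') =
      g.c - ((m / 2 : ℕ) : ℤ) * lf n A B + (h.c - ((m / 2 : ℕ) : ℤ) * lf n A' B')
        + ∑ i, g.a i * h.b i := by rw [Heis.mul_c]; ring
    rw [e]; exact this
  inv_mem' := by
    rintro g ⟨A, B, ha, hb, hc⟩
    refine ⟨-A, -B, by simp [ha], by simp [hb], ?_⟩
    rw [lf_neg]
    have : (m : ℤ) ∣ ∑ i, g.a i * g.b i := by
      apply Finset.dvd_sum
      intro i _
      rw [ha]
      exact Dvd.dvd.mul_right ⟨A i, by simp⟩ _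
    have := dvd_add (dvd_neg.mpr hc) this
    have e : (g⁻¹).c - ((m / 2 : ℕ) : ℤ) * (-lf n A B) =
      -(g.c - ((m / 2 : ℕ) : ℤ) * lf n A B)
        + ∑ i, g.a i * g.b i := by rw [Heis.inv_c]; ring
    rw [e]; exact this

lemma E_le_F (n m : ℕ) : Esub n m ≤ FF n m := by
  unfold Esub
  rw [Subgroup.closure_le]
  rintro g (⟨i, h1, h2, rfl⟩ | rfl)
  · obtain ⟨j, rfl⟩ | ⟨j, rfl⟩ := xg_cases i h1 h2
    · rw [xg_lo, hp_a, hp_z]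
      refine ⟨Pi.single j 1, 0, by simp, by simp, ?_⟩
      simp [lf, Pi.single_apply]
      ring_nf; simp
    · rw [xg_hi, hp_b, hp_z]
      refine ⟨0, Pi.single j 1, by simp, by simp, ?_⟩
      have : vcoef n (n + 1 + j) = 1 := by unfold vcoef; rw [if_pos (by omega)]
      simp [lf, this]
  · rw [hp_z]
    exact ⟨0, 0, by simp, by simp, by simp [lf]⟩

lemma zz_mem_E (n m : ℕ) (c : ℤ) (h : (m : ℤ) ∣ c) : zz n ^ c ∈ Esub n m := by
  obtain ⟨d, rfl⟩ := h
  rw [zpow_mul]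
  apply Subgroup.zpow_mem
  rw [zpow_natCast]
  exact Subgroup.subset_closure (Or.inr rfl)

lemma mk_mem {n : ℕ} {S : Subgroup (Heis n)} {g : Heis n} (hg : g ∈ S) {a b : Fin n → ℤ}
    (ha : g.a = a) (hb : g.b = b) : ∃ c, (⟨a, b, c⟩ : Heis n) ∈ S := by
  subst ha hb
  exact ⟨g.c, hg⟩

lemma gen_lift (n : ℕ) (T : Subgroup (Heis n)) (m : ℤ)
    (h1 : ∀ i : Fin n, ∃ c, (⟨m • Pi.single i 1, 0, c⟩ : Heis n) ∈ T)
    (h2 : ∀ i : Fin n, ∃ c, (⟨0, m • Pi.single i 1, c⟩ : Heis n) ∈ T) (A B : Fin n → ℤ) :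
    ∃ c, (⟨m • A, m • B, c⟩ : Heis n) ∈ T := by
  let S : AddSubgroup ((Fin n → ℤ) × (Fin n → ℤ)) :=
    { carrier := {p | ∃ c, (⟨m • p.1, m • p.2, c⟩ : Heis n) ∈ T}
      zero_mem' := mk_mem T.one_mem (by simp) (by simp)
      add_mem' := by
        rintro p q ⟨c, hc⟩ ⟨d, hd⟩
        exact mk_mem (T.mul_mem hc hd) (by simp) (by simp)
      neg_mem' := by
        rintro p ⟨c, hc⟩
        exact mk_mem (T.inv_mem hc) (by simp) (by simp) }
  have hS1 : ∀ i : Fin n, ((Pi.single i 1, 0) : (Fin n → ℤ) × (Fin n → ℤ)) ∈ S := by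
    intro i
    obtain ⟨c, hc⟩ := h1 i
    exact mk_mem hc (by simp) (by simp)
  have hS2 : ∀ i : Fin n, ((0, Pi.single i 1) : (Fin n → ℤ) × (Fin n → ℤ)) ∈ S := by
    intro i
    obtain ⟨c, hc⟩ := h2 i
    exact mk_mem hc (by simp) (by simp)
  have : (A, B) ∈ S := by
    have e : (A, B) = ∑ i, A i • ((Pi.single i 1, 0) : (Fin n → ℤ) × (Fin n → ℤ))
        + ∑ i, B i • ((0, Pi.single i 1) : (Fin n → ℤ) × (Fin n → ℤ)) := by
      ext j <;> simp [Prod.fst_sum, Prod.snd_sum, Finset.sum_apply, Pi.single_apply]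
    rw [e]
    exact S.add_mem (S.sum_mem fun i _ => S.zsmul_mem (hS1 i) _)
      (S.sum_mem fun i _ => S.zsmul_mem (hS2 i) _)
  exact this

lemma E_lift (n m : ℕ) (A B : Fin n → ℤ) :
    ∃ c, (⟨(m : ℤ) • A, (m : ℤ) • B, c⟩ : Heis n) ∈ Esub n m := by
  apply gen_lift
  · intro i
    have : xg n (i + 1) ^ m * zz n ^ (vcoef n (i+1) * (m / 2)) ∈ Esub n m :=
      Subgroup.subset_closure (Or.inl ⟨i + 1, by omega, by omega, rfl⟩)
    rw [xg_lo, hp_a, hp_z] at this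
    exact mk_mem this (by simp) (by simp)
  · intro i
    have : xg n (n + 1 + i) ^ m * zz n ^ (vcoef n (n + 1 + i) * (m / 2)) ∈ Esub n m :=
      Subgroup.subset_closure (Or.inl ⟨n + 1 + i, by omega, by omega, rfl⟩)
    rw [xg_hi, hp_b, hp_z] at this
    exact mk_mem this (by simp) (by simp)

/-- an element with vanishing a,b is a power of z -/
lemma eq_zz {n : ℕ} (g : Heis n) (ha : g.a = 0) (hb : g.b = 0) : g = zz n ^ g.c := by
  rw [hp_zz]; ext <;> simp [ha, hb]

lemma zz_mem_F (n m : ℕ) (hm : 2 ≤ m) (c : ℤ) : zz n ^ c ∈ FF n m ↔ (m : ℤ) ∣ c := by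
  rw [hp_zz]
  constructor
  · rintro ⟨A, B, ha, hb, hc⟩
    have hA : A = 0 := by
      have := ha.symm; rw [smul_eq_zero] at this; rcases this with h | h; omega; exact h
    have hB : B = 0 := by
      have := hb.symm; rw [smul_eq_zero] at this; rcases this with h | h; omega; exact h
    subst hA hB
    simpa [lf] using hc
  · intro h
    exact ⟨0, 0, by simp, by simp, by simpa [lf] using h⟩

lemma E_eq_F (n m : ℕ) (hm : 2 ≤ m) : Esub n m = FF n m := by
  apply le_antisymm (E_le_F n m)
  intro g hg
  have hg' := hg
  obtain ⟨A, B, ha, hb, -⟩ := hg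
  obtain ⟨c, hc⟩ := E_lift n m A B
  have h1 := (FF n m).mul_mem hg' ((FF n m).inv_mem (E_le_F n m hc))
  have h2 := eq_zz (g * (⟨(m : ℤ) • A, (m : ℤ) • B, c⟩ : Heis n)⁻¹) (by simp [ha]) (by simp [hb])
  rw [h2, zz_mem_F n m hm] at h1
  have h3 := zz_mem_E n m _ h1
  rw [← h2] at h3
  have := (Esub n m).mul_mem h3 hc
  simpa using this

lemma zz_mem (n m : ℕ) (hm : 2 ≤ m) (c : ℤ) : zz n ^ c ∈ Esub n m ↔ (m : ℤ) ∣ c := by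
  rw [E_eq_F n m hm, zz_mem_F n m hm]

lemma xpow_mem (n m : ℕ) (hn : 1 ≤ n) (hm : 2 ≤ m) (hme : Even m) (j : ℕ) :
    xg n (n + 1) ^ j ∈ Esub n m ↔ 2 * m ∣ j := by
  rw [E_eq_F n m hm]
  have := xg_hi (⟨0, hn⟩ : Fin n)
  simp only [add_zero] at this
  rw [this, hp_b]
  obtain ⟨r, rfl⟩ := hme
  have hr : (r + r) / 2 = r := by omega
  constructor
  · rintro ⟨A, B, ha, hb, hc⟩
    have hA : A = 0 := by
      have := ha.symm; rw [smul_eq_zero] at this; rcases this with h | h; omega; exact h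
    subst hA
    have hb0 : ∀ i, (j : ℤ) * (Pi.single (⟨0, hn⟩ : Fin n) (1 : ℤ) : Fin n → ℤ) i
        = ((r + r : ℕ) : ℤ) * B i := fun i => by
      simpa using congrFun hb i
    have hB : ∀ i, i ≠ ⟨0, hn⟩ → B i = 0 := by
      intro i hi
      have := hb0 i
      rw [Pi.single_eq_of_ne hi] at this
      simp at this
      omega
    have hs : ∑ i, B i = B ⟨0, hn⟩ := by
      apply Finset.sum_eq_single_of_mem _ (Finset.mem_univ _)
      intro i _ hi; exact hB i hi
    have h0 := hb0 ⟨0, hn⟩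
    simp only [Pi.single_eq_same, mul_one] at h0
    rw [hr] at hc
    simp only [lf, hs] at hc
    simp at hc
    have hc' : (r : ℤ) * 2 ∣ r * B ⟨0, hn⟩ := by
      rwa [mul_two]
    have := Int.dvd_of_mul_dvd_mul_left (by omega : (r : ℤ) ≠ 0) hc'
    obtain ⟨d, hd⟩ := this
    rw [hd] at h0
    zify
    exact ⟨d, by rw [h0]; push_cast; ring⟩
  · rintro ⟨d, rfl⟩
    refine ⟨0, Pi.single ⟨0, hn⟩ (2 * d), by simp, ?_, ?_⟩
    · ext i
      simp [Pi.single_apply]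
      split_ifs <;> ring
    · rw [hr]
      simp [lf]
      exact ⟨d, by ring⟩

lemma cardE (n m : ℕ) (hm : 2 ≤ m) : Nat.card (Heis n ⧸ Esub n m) = m ^ (2 * n + 1) := by
  let f : (Fin n → Fin m) × (Fin n → Fin m) × Fin m → Heis n ⧸ Esub n m :=
    fun p => QuotientGroup.mk ⟨fun i => (p.1 i : ℤ), fun i => (p.2.1 i : ℤ), (p.2.2 : ℤ)⟩
  have hm0 : (0 : ℤ) < m := by omega
  have hdv : ∀ x y : Fin m, ∀ d : ℤ, -(x : ℤ) + y = m * d → x = y := by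
    intro x y d h
    have hx := x.2
    have hy := y.2
    have : d = 0 := by
      have h1 : (m : ℤ) * d < m * 1 := by omega
      have h2 : (m : ℤ) * (-1) < m * d := by omega
      have := lt_of_mul_lt_mul_left h1 hm0.le
      have := lt_of_mul_lt_mul_left h2 hm0.le
      omega
    subst this
    ext; omega
  have hf : Function.Bijective f := by
    constructor
    · rintro ⟨a, b, c⟩ ⟨a', b', c'⟩ h
      have h := QuotientGroup.eq.mp h
      have h0 := h
      rw [E_eq_F n m hm] at h
      obtain ⟨A, B, hA, hB, -⟩ := h
      have ha : a = a' := by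
        funext i
        exact hdv _ _ (A i) (by simpa using congrFun hA i)
      have hb : b = b' := by
        funext i
        exact hdv _ _ (B i) (by simpa using congrFun hB i)
      subst ha hb
      rw [eq_zz (_ * _) (by ext; simp) (by ext; simp), zz_mem n m hm] at h0
      obtain ⟨d, hd⟩ := h0
      have := hdv c c' d (by rw [← hd]; simp; ring)
      rw [this]
    · intro q
      obtain ⟨g, rfl⟩ := QuotientGroup.mk_surjective q
      obtain ⟨e, he⟩ := E_lift n m (fun i => g.a i / m) (fun i => g.b i / m)
      set w : Heis n := ⟨(m : ℤ) • (fun i => g.a i / m), (m : ℤ) • (fun i => g.b i / m), e⟩ with hw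
      have hma : (g * w⁻¹).a = fun i => g.a i % m := by
        ext i; simp [hw]; rw [Int.emod_def]; ring
      have hmb : (g * w⁻¹).b = fun i => g.b i % m := by
        ext i; simp [hw]; rw [Int.emod_def]; ring
      have hlt : ∀ x : ℤ, ((x % m).toNat) < m := fun x => by
        have := Int.emod_lt_of_pos x hm0
        omega
      have hnn : ∀ x : ℤ, ((x % m).toNat : ℤ) = x % m := fun x =>
        Int.toNat_of_nonneg (Int.emod_nonneg _ hm0.ne')
      refine ⟨⟨fun i => ⟨_, hlt (g.a i)⟩, fun i => ⟨_, hlt (g.b i)⟩, ⟨_, hlt (g * w⁻¹).c⟩⟩, ?_⟩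
      have h1 : (QuotientGroup.mk g : Heis n ⧸ Esub n m) = QuotientGroup.mk (g * w⁻¹) :=
        QuotientGroup.eq.mpr (by simpa using he)
      rw [h1]
      refine QuotientGroup.eq.mpr ?_
      have key : (g * w⁻¹) = (⟨fun i => g.a i % m, fun i => g.b i % m, (g * w⁻¹).c⟩ : Heis n) :=
        Heis.ext hma hmb rfl
      generalize (g * w⁻¹).c = c at *
      rw [key]
      simp only [hnn]
      rw [eq_zz (_ * _) (by ext; simp) (by ext; simp), zz_mem n m hm]
      refine ⟨c / m, ?_⟩
      have := Int.emod_def c m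
      simp [this]
      ring
  rw [← Nat.card_congr (Equiv.ofBijective f hf)]
  simp
  ring

def yy (n : ℕ) (b : MulAut (Heis n)) (j : ℕ) : Heis n := (b ^ j) (xg n (n + 1))

def Pf (n : ℕ) (b : MulAut (Heis n)) (s : ℕ) : ℕ → Heis n
  | 0 => 1
  | l + 1 => Pf n b s l * (yy n b (s + l))⁻¹

def Qf (n : ℕ) (b : MulAut (Heis n)) : ℕ → Heis n
  | 0 => 1
  | l + 1 => (yy n b l)⁻¹ * Qf n b l

lemma b_yy (n : ℕ) (b : MulAut (Heis n)) (j : ℕ) : b (yy n b j) = yy n b (j + 1) := by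
  simp [yy, pow_succ']

lemma b_Pf (n : ℕ) (b : MulAut (Heis n)) (s l : ℕ) : b (Pf n b s l) = Pf n b (s + 1) l := by
  induction l with
  | zero => simp [Pf]
  | succ l ih => rw [Pf, Pf, map_mul, map_inv, ih, b_yy, add_right_comm]

lemma b_Qf (n : ℕ) (b : MulAut (Heis n)) (l : ℕ) :
    b (Qf n b l) * (yy n b 0)⁻¹ = Qf n b (l + 1) := by
  induction l with
  | zero => simp [Qf]
  | succ l ih => rw [Qf, map_mul, map_inv, b_yy, mul_assoc, ih, ← Qf]

lemma Pf_add (n : ℕ) (b : MulAut (Heis n)) (s l r : ℕ) :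
    Pf n b s l * Pf n b (s + l) r = Pf n b s (l + r) := by
  induction r with
  | zero => simp [Pf]
  | succ r ih => rw [Pf, ← mul_assoc, ih, ← add_assoc, Pf, add_assoc]

lemma yy_lo (n : ℕ) (b : MulAut (Heis n)) (hb : IsB n b) (j : ℕ) (hj : j < n) :
    yy n b j = xg n (n + 1 + j) := by
  induction j with
  | zero => simp [yy]
  | succ j ih =>
    rw [← b_yy, ih (by omega), hb.2.1 _ (by omega) (by omega)]
    rfl

lemma prod_Pf (n : ℕ) (b : MulAut (Heis n)) (hb : IsB n b) (l : ℕ) (hl : l ≤ n) :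
    ((List.range l).map fun j => (xg n (n + 1 + j))⁻¹).prod = Pf n b 0 l := by
  induction l with
  | zero => simp [Pf]
  | succ l ih =>
    rw [List.range_succ, List.map_append, List.prod_append, ih (by omega), Pf, zero_add,
      yy_lo n b hb l (by omega)]
    simp

lemma x_eq (n : ℕ) (b : MulAut (Heis n)) (hb : IsB n b) (i : ℕ) (hi : i < n) :
    xg n (i + 1) = Pf n b i (n + 1) * Qf n b i := by
  induction i with
  | zero =>
    have h := hb.2.2
    rw [prod_Pf n b hb n le_rfl] at h
    have h2 : xg n (2 * n) = yy n b (n - 1) := by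
      rw [yy_lo n b hb (n - 1) (by omega)]
      congr 1; omega
    rw [h2, b_yy, Nat.sub_add_cancel (by omega)] at h
    simp only [Pf, Qf, zero_add, mul_one]
    rw [h]; group
  | succ i ih =>
    have h := hb.1 (i + 1) (by omega) (by omega)
    rw [ih (by omega), map_mul, b_Pf] at h
    have h0 : xg n (n + 1) = yy n b 0 := by simp [yy]
    rw [← b_Qf, ← mul_assoc, h, h0, mul_inv_cancel_right]

lemma yy_period (n : ℕ) (hn : 1 ≤ n) (b : MulAut (Heis n)) (hb : IsB n b) :
    yy n b (2 * n + 1) = yy n b 0 := by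
  have h := hb.2.1 n le_rfl (by omega)
  have hx := x_eq n b hb (n - 1) (by omega)
  rw [Nat.sub_add_cancel hn] at hx
  have h0 : xg n (n + 1) = yy n b 0 := by simp [yy]
  rw [hx, map_mul, b_Pf, Nat.sub_add_cancel hn, h0] at h
  have h1 : Pf n b n (n + 1) * Qf n b n = 1 := by
    have := b_Qf n b (n - 1)
    rw [Nat.sub_add_cancel hn] at this
    rw [← this, ← mul_assoc, h, mul_inv_cancel]
  have ha : ∀ j < n, (yy n b j).a = 0 := by
    intro j hj
    rw [yy_lo n b hb j hj]
    have := xg_hi ⟨j, hj⟩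
    simp only at this
    rw [this]
  have hQa : ∀ l ≤ n, (Qf n b l).a = 0 := by
    intro l
    induction l with
    | zero => intro _; rfl
    | succ l ih => intro hl; simp [Qf, ih (by omega), ha l (by omega)]
  have hQP : ∀ l ≤ n, Qf n b l = Pf n b 0 l := by
    intro l
    induction l with
    | zero => intro _; rfl
    | succ l ih =>
      intro hl
      have h1 := hQa l (by omega)
      have h2 := ha l (by omega)
      rw [Qf, Pf, zero_add, ← ih (by omega)]
      ext <;> simp [h1, h2] <;> ring
  rw [hQP n le_rfl] at h1
  have h2 := mul_eq_one_comm.mp h1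
  have h3 := Pf_add n b 0 n (n + 1)
  rw [zero_add, h2] at h3
  have h4 : Pf n b 0 (2 * n + 1) = 1 := by rw [h3]; congr 1; ring
  have h5 : Pf n b 1 (2 * n + 1) = 1 := by
    have := b_Pf n b 0 (2 * n + 1)
    rw [h4, map_one, zero_add] at this
    exact this.symm
  have h6 := Pf_add n b 0 1 (2 * n)
  rw [add_comm 1, h4] at h6
  simp only [Pf, zero_add, one_mul, add_zero] at h6
  rw [Pf, add_comm 1] at h5
  exact ((inv_mul_eq_one.mp h6).trans (mul_inv_eq_one.mp h5)).symm

lemma gen_top (n : ℕ) (hn : 1 ≤ n) (b : MulAut (Heis n)) (hb : IsB n b) (S : Subgroup (Heis n))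
    (hS : ∀ j < 2 * n + 1, yy n b j ∈ S) : S = ⊤ := by
  have hP : ∀ s l, s + l ≤ 2 * n + 1 → Pf n b s l ∈ S := by
    intro s l
    induction l with
    | zero => intro _; exact S.one_mem
    | succ l ih => intro h; exact S.mul_mem (ih (by omega)) (S.inv_mem (hS _ (by omega)))
  have hQ : ∀ l, l ≤ 2 * n + 1 → Qf n b l ∈ S := by
    intro l
    induction l with
    | zero => intro _; exact S.one_mem
    | succ l ih => intro h; exact S.mul_mem (S.inv_mem (hS _ (by omega))) (ih (by omega))
  have h1 : ∀ i : Fin n, xg n (i + 1) ∈ S := fun i => by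
    have := i.2
    rw [x_eq n b hb i i.2]
    exact S.mul_mem (hP _ _ (by omega)) (hQ _ (by omega))
  have h2 : ∀ i : Fin n, xg n (n + 1 + i) ∈ S := fun i => by
    have := i.2
    rw [← yy_lo n b hb i i.2]
    exact hS _ (by omega)
  have hz : zz n ∈ S := by
    have a1 := h1 ⟨0, hn⟩
    have a2 := h2 ⟨0, hn⟩
    have : zz n = xg n (((⟨0, hn⟩ : Fin n) : ℕ) + 1) * xg n (n + 1 + ((⟨0, hn⟩ : Fin n) : ℕ)) *
      (xg n (((⟨0, hn⟩ : Fin n) : ℕ) + 1))⁻¹ * (xg n (n + 1 + ((⟨0, hn⟩ : Fin n) : ℕ)))⁻¹ := by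
      rw [xg_lo, xg_hi]
      ext <;> simp [zz, Pi.single_apply]
    rw [this]
    exact S.mul_mem (S.mul_mem (S.mul_mem a1 a2) (S.inv_mem a1)) (S.inv_mem a2)
  rw [eq_top_iff]
  intro g _
  obtain ⟨c, hc⟩ := gen_lift n S 1
    (fun i => by have := h1 i; rw [xg_lo] at this; exact mk_mem this (by simp) (by simp))
    (fun i => by have := h2 i; rw [xg_hi] at this; exact mk_mem this (by simp) (by simp)) g.a g.b
  have h3 := eq_zz (g * (⟨(1 : ℤ) • g.a, (1 : ℤ) • g.b, c⟩ : Heis n)⁻¹) (by simp) (by simp)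
  have h4 : g * (⟨(1 : ℤ) • g.a, (1 : ℤ) • g.b, c⟩ : Heis n)⁻¹ ∈ S := by
    rw [h3]; exact S.zpow_mem hz _
  simpa using S.mul_mem h4 hc

lemma zz_comm {n : ℕ} (g : Heis n) (c : ℤ) : zz n ^ c * g = g * zz n ^ c := by
  rw [hp_zz]; ext <;> simp; ring

lemma central_eq {n : ℕ} (h : Heis n) (hc : ∀ g, h * g = g * h) : ∃ c : ℤ, h = zz n ^ c := by
  refine ⟨h.c, eq_zz h ?_ ?_⟩
  · ext i
    have := congrArg Heis.c (hc ⟨0, Pi.single i 1, 0⟩)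
    simpa [Pi.single_apply] using this
  · ext i
    have := congrArg Heis.c (hc ⟨Pi.single i 1, 0, 0⟩)
    simpa [Pi.single_apply] using this.symm

lemma aut_zz {n : ℕ} (b : MulAut (Heis n)) : ∃ c : ℤ, b (zz n) = zz n ^ c := by
  apply central_eq
  intro g
  obtain ⟨g, rfl⟩ := b.surjective g
  rw [← map_mul, ← map_mul]
  have := zz_comm g 1
  rw [zpow_one] at this
  rw [this]

lemma zcomm_ne (n m : ℕ) (hn : 1 ≤ n) (hm : 2 ≤ m) [(Esub n m).Normal] :
    ¬ ∀ u v : Heis n ⧸ Esub n m, u * v = v * u := by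
  intro h
  have h0 := h (QuotientGroup.mk (xg n (n + 1 + ((⟨0, hn⟩ : Fin n) : ℕ))))
    (QuotientGroup.mk (xg n (((⟨0, hn⟩ : Fin n) : ℕ) + 1)))
  have h1 := QuotientGroup.eq.mp h0
  have : (xg n (n + 1 + ((⟨0, hn⟩ : Fin n) : ℕ)) * xg n (((⟨0, hn⟩ : Fin n) : ℕ) + 1))⁻¹ *
    (xg n (((⟨0, hn⟩ : Fin n) : ℕ) + 1) * xg n (n + 1 + ((⟨0, hn⟩ : Fin n) : ℕ))) =
      zz n ^ (1 : ℤ) := by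
    rw [xg_lo, xg_hi]
    ext <;> simp [zz, Pi.single_apply]
  have h2 : zz n ^ (1 : ℤ) ∈ Esub n m := by rw [← this]; exact h1
  rw [zz_mem n m hm] at h2
  have := Int.le_of_dvd one_pos h2
  omega

/-- For even `m ≥ 2` and `k = 2n+1` prime: in `H_k/E_k` the element
`x_{n+1}E_k` has order `2m` and the group has order `m^k`; the Cayley digraph
on `H_k/E_k` with connection set the image of `P_k` is a connected oriented
digraph of out-valency `k`; the group generated by right translations and the
automorphism induced by `b` preserves arcs and acts transitively on vertices
and arcs; and the cosets of the image of `⟨z⟩` form a system of blocks of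
imprimitivity of size `m` for this group. -/
theorem even_case_digraph (n m k : ℕ) (hn : 1 ≤ n) (hk : k = 2 * n + 1)
    (hp : Nat.Prime k) (hm : 2 ≤ m) (hme : Even m)
    (b : MulAut (Heis n)) (hb : IsB n b)
    (E : Subgroup (Heis n)) (hE : E = Esub n m) [E.Normal]
    (hbE : Subgroup.map (b : Heis n →* Heis n) E = E) :
    orderOf (QuotientGroup.mk (xg n (n + 1)) : Heis n ⧸ E) = 2 * m ∧
    Nat.card (Heis n ⧸ E) = m ^ k ∧
    (∀ u v : Heis n ⧸ E, Relation.EqvGen (PArc n k b E) u v) ∧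
    (∀ u v : Heis n ⧸ E, PArc n k b E u v → ¬ PArc n k b E v u) ∧
    (∀ u : Heis n ⧸ E, {v | PArc n k b E u v}.ncard = k) ∧
    (∀ σ ∈ CayGrp n b E hbE, ∀ u v : Heis n ⧸ E,
      PArc n k b E u v → PArc n k b E (σ u) (σ v)) ∧
    (∀ u v : Heis n ⧸ E, ∃ σ ∈ CayGrp n b E hbE, σ u = v) ∧
    (∀ u v u' v' : Heis n ⧸ E, PArc n k b E u v → PArc n k b E u' v' →
      ∃ σ ∈ CayGrp n b E hbE, σ u = u' ∧ σ v = v') ∧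
    (∀ g : Heis n ⧸ E, (zCoset n E g).ncard = m) ∧
    (∀ σ ∈ CayGrp n b E hbE, ∀ g : Heis n ⧸ E,
      ∃ g' : Heis n ⧸ E, σ '' zCoset n E g = zCoset n E g') := by
  subst hE hk
  set E := Esub n m with hEdef
  let β : MulAut (Heis n ⧸ E) := QuotientGroup.congr E E (b : Heis n ≃* Heis n) hbE
  let q : Heis n ⧸ E := QuotientGroup.mk (xg n (n + 1))
  have hβ : ∀ h : Heis n, β (QuotientGroup.mk h) = QuotientGroup.mk (b h) := fun h => rfl
  have hβp : ∀ (j : ℕ) (h : Heis n), (β ^ j) (QuotientGroup.mk h : Heis n ⧸ E) =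
      QuotientGroup.mk ((b ^ j) h) := by
    intro j
    induction j with
    | zero => intro h; rfl
    | succ j ih => intro h; rw [pow_succ, pow_succ, MulAut.mul_apply, MulAut.mul_apply, hβ, ih]
  have hmk : ∀ j : ℕ, (QuotientGroup.mk ((b ^ j) (xg n (n + 1))) : Heis n ⧸ E) = (β ^ j) q :=
    fun j => (hβp j _).symm
  have hper : (β ^ (2 * n + 1)) q = q := by
    rw [← hmk]
    have := yy_period n hn b hb
    simp only [yy, pow_zero] at this
    rw [this]; rfl
  have hord : orderOf q = 2 * m := by
    apply Nat.dvd_antisymm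
    · rw [orderOf_dvd_iff_pow_eq_one]
      exact (QuotientGroup.eq_one_iff _).mpr ((xpow_mem n m hn hm hme _).mpr dvd_rfl)
    · refine (xpow_mem n m hn hm hme _).mp ((QuotientGroup.eq_one_iff _).mp ?_)
      exact pow_orderOf_eq_one q
  -- generation
  have hgen : ∀ S : Subgroup (Heis n ⧸ E), (∀ j < 2 * n + 1, (β ^ j) q ∈ S) → S = ⊤ := by
    intro S hS
    have := gen_top n hn b hb (S.comap (QuotientGroup.mk' E)) (fun j hj => by
      rw [Subgroup.mem_comap]
      have := hS j hj
      rw [← hmk] at this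
      exact this)
    rw [eq_top_iff]
    intro u _
    obtain ⟨g, rfl⟩ := QuotientGroup.mk_surjective u
    have hg : g ∈ S.comap (QuotientGroup.mk' E) := by rw [this]; trivial
    exact hg
  -- minimal period
  have hiter : ∀ (j : ℕ) (u : Heis n ⧸ E), (⇑β)^[j] u = (β ^ j) u := by
    intro j
    induction j with
    | zero => intro u; rfl
    | succ j ih => intro u; rw [Function.iterate_succ_apply, ih, pow_succ, MulAut.mul_apply]
  have hmin : Function.minimalPeriod (⇑β) q = 2 * n + 1 := by
    have hd : Function.minimalPeriod (⇑β) q ∣ 2 * n + 1 := by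
      apply Function.IsPeriodicPt.minimalPeriod_dvd
      change (⇑β)^[2 * n + 1] q = q
      rw [hiter, hper]
    rcases (Nat.dvd_prime hp).mp hd with h | h
    · exfalso
      have hfix : β q = q := Function.minimalPeriod_eq_one_iff_isFixedPt.mp h
      have hall : ∀ j : ℕ, (β ^ j) q = q := by
        intro j
        induction j with
        | zero => rfl
        | succ j ih => rw [pow_succ, MulAut.mul_apply, hfix, ih]
      have htop := hgen (Subgroup.zpowers q) (fun j _ => by
        rw [hall]; exact Subgroup.mem_zpowers q)
      apply zcomm_ne n m hn hm
      intro u v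
      have hu : u ∈ Subgroup.zpowers q := by rw [htop]; trivial
      have hv : v ∈ Subgroup.zpowers q := by rw [htop]; trivial
      obtain ⟨i, rfl⟩ := Subgroup.mem_zpowers_iff.mp hu
      obtain ⟨j, rfl⟩ := Subgroup.mem_zpowers_iff.mp hv
      rw [← zpow_add, ← zpow_add, add_comm]
    · exact h
  have hdvd : ∀ j : ℕ, (β ^ j) q = q → 2 * n + 1 ∣ j := by
    intro j h
    rw [← hmin]
    apply Function.IsPeriodicPt.minimalPeriod_dvd
    change (⇑β)^[j] q = q
    rw [hiter, h]
  have hinj : ∀ i < 2 * n + 1, ∀ j < 2 * n + 1, (β ^ i) q = (β ^ j) q → i = j := by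
    intro i hi j hj h
    rw [← hiter, ← hiter] at h
    exact Function.iterate_injOn_Iio_minimalPeriod (f := ⇑β) (x := q)
      (by rw [hmin]; exact hi) (by rw [hmin]; exact hj) h
  -- reformulating arcs
  have hper' : ∀ d : ℤ, (β ^ ((2 * n + 1 : ℕ) * d : ℤ)) q = q := by
    intro d
    have : β ^ (2 * n + 1) ∈ MulAction.stabilizer (MulAut (Heis n ⧸ E)) q := hper
    have := Subgroup.zpow_mem _ this d
    rw [← zpow_natCast, ← zpow_mul] at this
    exact this
  have hred : ∀ d : ℤ, ∃ j < 2 * n + 1, (β ^ d) q = (β ^ j) q := by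
    intro d
    have hpos : (0 : ℤ) < (2 * n + 1 : ℕ) := by omega
    have h1 := Int.emod_nonneg d hpos.ne'
    have h2 := Int.emod_lt_of_pos d hpos
    refine ⟨(d % (2 * n + 1 : ℕ)).toNat, by omega, ?_⟩
    have h3 : d = d % (2 * n + 1 : ℕ) + (2 * n + 1 : ℕ) * (d / (2 * n + 1 : ℕ)) :=
      (Int.emod_add_mul_ediv _ _).symm
    rw [← zpow_natCast, Int.toNat_of_nonneg h1]
    conv_lhs => rw [h3]
    rw [zpow_add, MulAut.mul_apply, hper']
  have harc : ∀ u v : Heis n ⧸ E, PArc n (2 * n + 1) b E u v ↔ ∃ d : ℤ, v = (β ^ d) q * u := by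
    intro u v
    constructor
    · rintro ⟨j, hj, rfl⟩
      exact ⟨j, by rw [hmk, zpow_natCast]⟩
    · rintro ⟨d, rfl⟩
      obtain ⟨j, hj, h⟩ := hred d
      exact ⟨j, hj, by rw [hmk, h]⟩
  have hR : ∀ h : Heis n ⧸ E, Equiv.mulRight h ∈ CayGrp n b E hbE := fun h =>
    Subgroup.subset_closure (Or.inl ⟨h, rfl⟩)
  have hB : MulEquiv.toEquiv β ∈ CayGrp n b E hbE := Subgroup.subset_closure (Or.inr rfl)
  have hBz : ∀ d : ℤ, ∃ σ ∈ CayGrp n b E hbE, ∀ u, σ u = (β ^ d) u := by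
    intro d
    refine ⟨MulAut.toPerm _ (β ^ d), ?_, fun u => rfl⟩
    rw [map_zpow]
    exact Subgroup.zpow_mem _ hB d
  have hzpow : ∀ (c : ℤ), (QuotientGroup.mk (zz n ^ c) : Heis n ⧸ E) = QuotientGroup.mk (zz n) ^ c :=
    fun c => rfl
  have hzo : orderOf (QuotientGroup.mk (zz n) : Heis n ⧸ E) = m := by
    apply Nat.dvd_antisymm
    · rw [orderOf_dvd_iff_pow_eq_one]
      refine (QuotientGroup.eq_one_iff (zz n ^ m)).mpr ?_
      rw [← zpow_natCast, zz_mem n m hm]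
    · have h := pow_orderOf_eq_one (QuotientGroup.mk (zz n) : Heis n ⧸ E)
      have h := (QuotientGroup.eq_one_iff (zz n ^ _)).mp h
      rw [← zpow_natCast, zz_mem n m hm] at h
      exact_mod_cast h
  refine ⟨hord, cardE n m hm, ?_, ?_, ?_, ?_, ?_, ?_, ?_, ?_⟩
  · let S : Subgroup (Heis n ⧸ E) :=
      { carrier := {g | ∀ u, Relation.EqvGen (PArc n (2 * n + 1) b E) u (g * u)}
        one_mem' := fun u => by rw [one_mul]; exact .refl _
        mul_mem' := fun {g h} hg hh u => by
          rw [mul_assoc]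
          exact .trans _ _ _ (hh u) (hg (h * u))
        inv_mem' := fun {g} hg u => by
          have := hg (g⁻¹ * u)
          rw [mul_inv_cancel_left] at this
          exact .symm _ _ this }
    have hS : S = ⊤ := hgen S (fun j hj u => .rel _ _ ⟨j, hj, by rw [hmk]⟩)
    intro u v
    have : v * u⁻¹ ∈ S := by rw [hS]; trivial
    have := this u
    rwa [inv_mul_cancel_right] at this
  · rintro u v h1 ⟨j, hj, h2⟩
    obtain ⟨i, hi, rfl⟩ := h1
    rw [hmk, hmk, ← mul_assoc] at h2
    have h3 : (β ^ j) q * (β ^ i) q = 1 := by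
      have := h2.symm
      rwa [mul_eq_right] at this
    -- d = j + k - i
    have h4 : (β ^ (j + (2 * n + 1 - i))) q = q⁻¹ := by
      have hi' : (β ^ (2 * n + 1 - i)) ((β ^ i) q) = q := by
        rw [← MulAut.mul_apply, ← pow_add, Nat.sub_add_cancel hi.le, hper]
      have h5 : (β ^ j) q = ((β ^ i) q)⁻¹ := eq_inv_of_mul_eq_one_left h3
      rw [add_comm, pow_add, MulAut.mul_apply, h5, map_inv, hi']
    have h5 : (β ^ (2 * (j + (2 * n + 1 - i)))) q = q := by
      rw [two_mul, pow_add, MulAut.mul_apply, h4, map_inv, h4, inv_inv]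
    have h6 := hdvd _ h5
    have h7 : 2 * n + 1 ∣ j + (2 * n + 1 - i) := by
      refine Nat.Coprime.dvd_of_dvd_mul_left ?_ h6
      simp
    obtain ⟨d, hd⟩ := h7
    have h8 := hper' d
    rw [hd] at h4
    rw [← Nat.cast_mul, zpow_natCast, h4] at h8
    have h9 : q ^ 2 = 1 := by rw [pow_two]; nth_rewrite 1 [← h8]; simp
    have := orderOf_dvd_of_pow_eq_one h9
    rw [hord] at this
    have := Nat.le_of_dvd (by norm_num) this
    omega
  · intro u
    have : {v | PArc n (2 * n + 1) b E u v} =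
        (fun j : ℕ => (β ^ j) q * u) '' (Finset.range (2 * n + 1) : Finset ℕ) := by
      ext v
      constructor
      · rintro ⟨j, hj, rfl⟩
        exact ⟨j, by simpa using hj, by simp only [hmk]⟩
      · rintro ⟨j, hj, rfl⟩
        exact ⟨j, by simpa using hj, by simp only [hmk]⟩
    rw [this, Set.ncard_image_of_injOn, Set.ncard_coe_finset, Finset.card_range]
    intro i hi j hj h
    exact hinj i (by simpa using hi) j (by simpa using hj) (mul_right_cancel h)
  · intro σ hσ
    have key : ∀ u v, PArc n (2 * n + 1) b E u v ↔ PArc n (2 * n + 1) b E (σ u) (σ v) := by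
      refine Subgroup.closure_induction (p := fun σ _ => ∀ u v, PArc n (2 * n + 1) b E u v ↔
        PArc n (2 * n + 1) b E (σ u) (σ v)) ?_ ?_ ?_ ?_ hσ
      · rintro _ (⟨h, rfl⟩ | rfl) u v
        · rw [harc, harc]
          refine exists_congr fun d => ?_
          change _ ↔ v * h = _ * (u * h)
          rw [← mul_assoc, mul_left_inj]
        · rw [harc, harc]
          change _ ↔ ∃ d : ℤ, β v = (β ^ d) q * β u
          constructor
          · rintro ⟨d, rfl⟩
            refine ⟨1 + d, ?_⟩
            rw [map_mul, zpow_add, zpow_one, MulAut.mul_apply]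
          · rintro ⟨d, h⟩
            refine ⟨-1 + d, β.injective ?_⟩
            rw [map_mul, h, ← MulAut.mul_apply]
            congr 3
            group
      · intro u v; rfl
      · intro σ τ _ _ h1 h2 u v
        rw [h2, h1]; rfl
      · intro σ _ h u v
        rw [h (σ⁻¹ u)]; simp
    intro u v h
    exact (key u v).mp h
  · intro u v
    exact ⟨Equiv.mulRight (u⁻¹ * v), hR _, by simp⟩
  · intro u v u' v' h h'
    obtain ⟨d, rfl⟩ := (harc _ _).mp h
    obtain ⟨d', rfl⟩ := (harc _ _).mp h'
    obtain ⟨τ, hτ, hτ'⟩ := hBz (d' - d)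
    refine ⟨Equiv.mulRight u' * τ * Equiv.mulRight u⁻¹,
      Subgroup.mul_mem _ (Subgroup.mul_mem _ (hR _) hτ) (hR _), ?_, ?_⟩
    · simp [hτ']
    · simp only [Equiv.Perm.mul_apply, Equiv.coe_mulRight, mul_inv_cancel_right, hτ']
      rw [← MulAut.mul_apply, ← zpow_add, sub_add_cancel]
  · intro g
    have : zCoset n E g = (fun w => w * g) ''
        (Subgroup.zpowers (QuotientGroup.mk (zz n) : Heis n ⧸ E) : Set (Heis n ⧸ E)) := by
      ext v
      constructor
      · rintro ⟨c, rfl⟩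
        exact ⟨_, ⟨c, rfl⟩, rfl⟩
      · rintro ⟨_, ⟨c, rfl⟩, rfl⟩
        exact ⟨c, rfl⟩
    rw [this, Set.ncard_image_of_injective _ (mul_left_injective g)]
    have h := Nat.card_zpowers (QuotientGroup.mk (zz n) : Heis n ⧸ E)
    rw [hzo] at h
    exact h
  · intro σ hσ g
    refine ⟨σ g, ?_⟩
    revert g
    refine Subgroup.closure_induction (p := fun (σ : Equiv.Perm (Heis n ⧸ E)) _ => ∀ g, σ '' zCoset n E g =
        zCoset n E (σ g)) ?_ ?_ ?_ ?_ hσ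
    · rintro _ (⟨h, rfl⟩ | rfl) g
      · ext v
        constructor
        · rintro ⟨_, ⟨c, rfl⟩, rfl⟩
          exact ⟨c, mul_assoc _ _ _⟩
        · rintro ⟨c, rfl⟩
          exact ⟨_, ⟨c, rfl⟩, mul_assoc _ _ _⟩
      · obtain ⟨e, he⟩ := aut_zz b
        obtain ⟨f, hf⟩ := aut_zz b⁻¹
        ext v
        constructor
        · rintro ⟨_, ⟨c, rfl⟩, rfl⟩
          refine ⟨e * c, ?_⟩
          change β (_ * g) = _ * β g
          rw [map_mul, hβ, map_zpow, he, zpow_mul]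
        · rintro ⟨c, rfl⟩
          refine ⟨_, ⟨f * c, rfl⟩, ?_⟩
          change β (_ * g) = _ * β g
          rw [map_mul, hβ, zpow_mul, ← hf, map_zpow, MulAut.apply_inv_self]
    · intro g; simp
    · intro σ τ _ _ h1 h2 g
      rw [Equiv.Perm.coe_mul, Set.image_comp, h2, h1]; rfl
    · intro σ _ h g
      have := h (σ⁻¹ g)
      rw [show σ (σ⁻¹ g) = g by simp] at this
      rw [← this, ← Set.image_comp, ← Equiv.Perm.coe_mul]
      simp
end

section
/- Let m ≥ 3 be an integer and let A_m = (ℤ/3ℤ) × (ℤ/mℤ). Consider the Cayley digraph on A_m with connection set S = {(1,1), (1,−1)}, i.e., arc set {(g, s+g) : g ∈ A_m, s ∈ S}. Then this digraph is connected, its arc relation is asymmetric (it is an oriented digraph), every vertex has exactly 2 out-neighbours, the group of permutations of A_m generated by all translations together with the group automorphism τ : (x,y) ↦ (x,−y) preserves the arc relation and acts transitively on vertices and on arcs, and the cosets of the subgroup {0} × (ℤ/mℤ) form a system of blocks of imprimitivity of size m for this group. -/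
/-- The arc relation of the Cayley digraph on `A_m = (ℤ/3ℤ) × (ℤ/mℤ)` with
connection set `S = {(1,1), (1,-1)}`. -/
def CycArc (m : ℕ) (g h : ZMod 3 × ZMod m) : Prop :=
  h = ((1 : ZMod 3), (1 : ZMod m)) + g ∨ h = ((1 : ZMod 3), (-1 : ZMod m)) + g

/-- The group of permutations of `A_m` generated by all translations together
with the automorphism `τ : (x, y) ↦ (x, -y)`. -/
def CycGrp (m : ℕ) : Subgroup (Equiv.Perm (ZMod 3 × ZMod m)) :=
  Subgroup.closure
    (Set.range (fun g : ZMod 3 × ZMod m => Equiv.addRight g) ∪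
      {(Equiv.refl (ZMod 3)).prodCongr (Equiv.neg (ZMod m))})

def connSub (m : ℕ) : AddSubgroup (ZMod 3 × ZMod m) where
  carrier := {t | ∀ u, Relation.EqvGen (CycArc m) u (t + u)}
  zero_mem' := by
    intro u
    rw [zero_add]
    exact Relation.EqvGen.refl u
  add_mem' := by
    intro a b ha hb u
    rw [add_assoc]
    exact (hb u).trans _ _ _ (ha (b + u))
  neg_mem' := by
    intro a ha u
    have h := ha (-a + u)
    rw [add_neg_cancel_left] at h
    exact h.symm _ _

lemma connSub_top (m : ℕ) [NeZero m] (t : ZMod 3 × ZMod m) : t ∈ connSub m := by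
  have h1 : ((1, 1) : ZMod 3 × ZMod m) ∈ connSub m :=
    fun u => Relation.EqvGen.rel _ _ (Or.inl rfl)
  have h2 : ((1, -1) : ZMod 3 × ZMod m) ∈ connSub m :=
    fun u => Relation.EqvGen.rel _ _ (Or.inr rfl)
  have h3 : ((0, 1) : ZMod 3 × ZMod m) ∈ connSub m := by
    have := add_mem (add_mem h1 h2) h2
    have h := neg_mem this
    convert h using 1
    ext
    · simp; decide
    · simp
  have h4 : ((1, 0) : ZMod 3 × ZMod m) ∈ connSub m := by
    have h := sub_mem h1 h3
    convert h using 1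
    ext <;> simp
  have h := add_mem (nsmul_mem h4 t.1.val) (nsmul_mem h3 t.2.val)
  convert h using 1
  ext <;> simp

lemma grp_form (m : ℕ) (σ : Equiv.Perm (ZMod 3 × ZMod m)) (hσ : σ ∈ CycGrp m) :
    ∃ g : ZMod 3 × ZMod m, (∀ p, σ p = (p.1, p.2) + g) ∨ (∀ p, σ p = (p.1, -p.2) + g) := by
  unfold CycGrp at hσ
  induction hσ using Subgroup.closure_induction with
  | mem x hx =>
    rcases hx with ⟨g, rfl⟩ | hx
    · exact ⟨g, Or.inl fun p => rfl⟩
    · rw [Set.mem_singleton_iff] at hx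
      subst hx
      exact ⟨0, Or.inr fun p => by simp; rfl⟩
  | one => exact ⟨0, Or.inl fun p => by simp⟩
  | mul x y _ _ hx hy =>
    obtain ⟨a, ha⟩ := hx
    obtain ⟨b, hb⟩ := hy
    rcases ha with ha | ha <;> rcases hb with hb | hb
    · exact ⟨b + a, Or.inl fun p => by
        rw [Equiv.Perm.mul_apply, hb, ha]; ext <;> simp <;> ring⟩
    · exact ⟨b + a, Or.inr fun p => by
        rw [Equiv.Perm.mul_apply, hb, ha]; ext <;> simp <;> ring⟩
    · exact ⟨(b.1, -b.2) + a, Or.inr fun p => by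
        rw [Equiv.Perm.mul_apply, hb, ha]; ext <;> simp <;> ring⟩
    · exact ⟨(b.1, -b.2) + a, Or.inl fun p => by
        rw [Equiv.Perm.mul_apply, hb, ha]; ext <;> simp <;> ring⟩
  | inv x _ hx =>
    obtain ⟨a, ha | ha⟩ := hx
    · exact ⟨-a, Or.inl fun p => by
        rw [Equiv.Perm.inv_eq_iff_eq, ha]; ext <;> simp⟩
    · exact ⟨(-a.1, a.2), Or.inr fun p => by
        rw [Equiv.Perm.inv_eq_iff_eq, ha]; ext <;> simp⟩

lemma trans_mem (m : ℕ) (g : ZMod 3 × ZMod m) : Equiv.addRight g ∈ CycGrp m :=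
  Subgroup.subset_closure (Or.inl ⟨g, rfl⟩)

lemma tau_mem (m : ℕ) :
    (Equiv.refl (ZMod 3)).prodCongr (Equiv.neg (ZMod m)) ∈ CycGrp m :=
  Subgroup.subset_closure (Or.inr rfl)

lemma refl_mem (m : ℕ) (u w : ZMod 3 × ZMod m) : ∃ σ ∈ CycGrp m,
    ∀ t : ZMod 3 × ZMod m, σ (t + u) = (t.1, -t.2) + w := by
  refine ⟨Equiv.addRight w * ((Equiv.refl (ZMod 3)).prodCongr (Equiv.neg (ZMod m)))
    * Equiv.addRight (-u), mul_mem (mul_mem (trans_mem m _) (tau_mem m)) (trans_mem m _), ?_⟩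
  intro t
  simp [Equiv.Perm.mul_apply]
  rfl

lemma shift_mem (m : ℕ) (u w : ZMod 3 × ZMod m) : ∃ σ ∈ CycGrp m,
    ∀ t : ZMod 3 × ZMod m, σ (t + u) = t + w := by
  refine ⟨Equiv.addRight (-u + w), trans_mem m _, ?_⟩
  intro t
  simp [add_assoc]

lemma block_iff (m : ℕ) (g q : ZMod 3 × ZMod m) :
    (∃ y : ZMod m, q = ((0 : ZMod 3), y) + g) ↔ q.1 = g.1 := by
  constructor
  · rintro ⟨y, rfl⟩; simp
  · intro h
    exact ⟨q.2 - g.2, by ext <;> simp [h]⟩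

/-- For `m ≥ 3`, the Cayley digraph on `A_m = (ℤ/3ℤ) × (ℤ/mℤ)` with connection
set `{(1,1), (1,-1)}` is a connected oriented digraph of out-valency 2; the
group generated by all translations together with `τ : (x,y) ↦ (x,-y)`
preserves its arcs and acts transitively on vertices and arcs; and the cosets
of `{0} × (ℤ/mℤ)` form a system of blocks of imprimitivity of size `m`. -/
theorem valency_two_digraph (m : ℕ) (hm : 3 ≤ m) :
    (∀ u v : ZMod 3 × ZMod m, Relation.EqvGen (CycArc m) u v) ∧
    (∀ u v : ZMod 3 × ZMod m, CycArc m u v → ¬ CycArc m v u) ∧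
    (∀ u : ZMod 3 × ZMod m, {v | CycArc m u v}.ncard = 2) ∧
    (∀ σ ∈ CycGrp m, ∀ u v : ZMod 3 × ZMod m,
      CycArc m u v → CycArc m (σ u) (σ v)) ∧
    (∀ u v : ZMod 3 × ZMod m, ∃ σ ∈ CycGrp m, σ u = v) ∧
    (∀ u v u' v' : ZMod 3 × ZMod m, CycArc m u v → CycArc m u' v' →
      ∃ σ ∈ CycGrp m, σ u = u' ∧ σ v = v') ∧
    (∀ g : ZMod 3 × ZMod m,
      {q : ZMod 3 × ZMod m | ∃ y : ZMod m, q = ((0 : ZMod 3), y) + g}.ncard = m) ∧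
    (∀ σ ∈ CycGrp m, ∀ g : ZMod 3 × ZMod m, ∃ g' : ZMod 3 × ZMod m,
      σ '' {q : ZMod 3 × ZMod m | ∃ y : ZMod m, q = ((0 : ZMod 3), y) + g} =
        {q : ZMod 3 × ZMod m | ∃ y : ZMod m, q = ((0 : ZMod 3), y) + g'}) := by
  have : NeZero m := ⟨by omega⟩
  refine ⟨?_, ?_, ?_, ?_, ?_, ?_, ?_, ?_⟩
  · intro u v
    have h := connSub_top m (v - u) u
    rwa [sub_add_cancel] at h
  · intro u v h1 h2
    have e1 : v.1 = 1 + u.1 := by rcases h1 with rfl | rfl <;> rfl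
    have e2 : u.1 = 1 + v.1 := by rcases h2 with h | h <;> (rw [h]; rfl)
    generalize u.1 = a at e1 e2
    generalize v.1 = b at e1 e2
    revert a b
    decide
  · intro u
    have : {v | CycArc m u v} = {((1 : ZMod 3), (1 : ZMod m)) + u, ((1 : ZMod 3), (-1 : ZMod m)) + u} := by
      ext v; rfl
    rw [this]
    apply Set.ncard_pair
    intro h
    have h2 : (1 : ZMod m) = -1 := congrArg Prod.snd (add_right_cancel h)
    have : Fact (2 < m) := ⟨hm⟩
    exact ZMod.neg_one_ne_one h2.symm
  · intro σ hσ u v h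
    obtain ⟨g, hg | hg⟩ := grp_form m σ hσ
    · rcases h with rfl | rfl
      · left; rw [hg, hg]; ext <;> simp <;> ring
      · right; rw [hg, hg]; ext <;> simp <;> ring
    · rcases h with rfl | rfl
      · right; rw [hg, hg]; ext <;> simp <;> ring
      · left; rw [hg, hg]; ext <;> simp <;> ring
  · intro u v
    exact ⟨_, trans_mem m (-u + v), by simp⟩
  · intro u v u' v' h h'
    obtain ⟨σ, hσ, hs⟩ := shift_mem m u u'
    obtain ⟨ρ, hρ, hr⟩ := refl_mem m u u'
    have s0 : σ u = u' := by simpa using hs 0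
    have r0 : ρ u = u' := by
      have h0 := hr 0
      rw [zero_add] at h0
      rw [h0]
      ext <;> simp
    rcases h with rfl | rfl <;> rcases h' with rfl | rfl
    · exact ⟨σ, hσ, s0, hs _⟩
    · exact ⟨ρ, hρ, r0, hr _⟩
    · exact ⟨ρ, hρ, r0, by rw [hr]; simp⟩
    · exact ⟨σ, hσ, s0, hs _⟩
  · intro g
    have : {q : ZMod 3 × ZMod m | ∃ y : ZMod m, q = ((0 : ZMod 3), y) + g}
        = Set.range (fun y : ZMod m => ((0 : ZMod 3), y) + g) := by
      ext q
      simp only [Set.mem_ofPred_eq, Set.mem_range, eq_comm]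
    rw [this, Set.ncard_range_of_injective, Nat.card_zmod]
    intro a b h
    exact congrArg Prod.snd (add_right_cancel h)
  · intro σ hσ g
    refine ⟨σ g, ?_⟩
    have key : ∀ p, (σ p).1 = (σ g).1 ↔ p.1 = g.1 := by
      intro p
      obtain ⟨a, ha | ha⟩ := grp_form m σ hσ <;> rw [ha, ha] <;> simp
    ext q
    simp only [block_iff, Set.mem_image, Set.mem_ofPred_eq]
    constructor
    · rintro ⟨p, hp, rfl⟩
      exact (key p).2 hp
    · intro h
      refine ⟨σ.symm q, (key _).1 ?_, ?_⟩ <;> simp [h]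
end

section
/- Let A = (ℤ/4ℤ) × (ℤ/2ℤ) and consider the Cayley digraph on A with connection set S = {(1,0), (1,1)}, i.e., arc set {(g, s+g) : g ∈ A, s ∈ S}. Then this digraph is connected, its arc relation is asymmetric (it is an oriented digraph), it has 8 vertices, every vertex has exactly 2 out-neighbours, the group of permutations of A generated by all translations together with the group automorphism τ : (x,y) ↦ (x, y + x mod 2) (which swaps (1,0) and (1,1)) preserves the arc relation and acts transitively on vertices and on arcs, and the cosets of the subgroup generated by (2,0) form a system of blocks of imprimitivity of size 2 for this group. -/
/-- The arc relation of the Cayley digraph on `A = (ℤ/4ℤ) × (ℤ/2ℤ)` with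
connection set `S = {(1,0), (1,1)}`. -/
def Arc19 (g h : ZMod 4 × ZMod 2) : Prop :=
  h = ((1 : ZMod 4), (0 : ZMod 2)) + g ∨ h = ((1 : ZMod 4), (1 : ZMod 2)) + g

/-- The automorphism `τ : (x, y) ↦ (x, y + x mod 2)` of `(ℤ/4ℤ) × (ℤ/2ℤ)`,
as a permutation. -/
def tau19 : Equiv.Perm (ZMod 4 × ZMod 2) where
  toFun g := (g.1, g.2 + ZMod.castHom (show (2:ℕ) ∣ 4 by norm_num) (ZMod 2) g.1)
  invFun g := (g.1, g.2 + ZMod.castHom (show (2:ℕ) ∣ 4 by norm_num) (ZMod 2) g.1)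
  left_inv g := by revert g; decide
  right_inv g := by revert g; decide

/-- The group of permutations of `A` generated by all translations together
with `τ`. -/
def Grp19 : Subgroup (Equiv.Perm (ZMod 4 × ZMod 2)) :=
  Subgroup.closure
    (Set.range (fun g : ZMod 4 × ZMod 2 => Equiv.addRight g) ∪ {tau19})

instance arcDec19 (u v : ZMod 4 × ZMod 2) : Decidable (Arc19 u v) := by
  unfold Arc19; infer_instance

theorem tau_add19 : ∀ a b : ZMod 4 × ZMod 2, tau19 (a + b) = tau19 a + tau19 b := by decide

theorem trans_mem19 (g : ZMod 4 × ZMod 2) : Equiv.addRight g ∈ Grp19 :=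
  Subgroup.subset_closure (Or.inl ⟨g, rfl⟩)

theorem tau_mem19 : tau19 ∈ Grp19 := Subgroup.subset_closure (Or.inr rfl)

theorem arc_iff19 (σ : Equiv.Perm (ZMod 4 × ZMod 2)) (h : σ ∈ Grp19) :
    ∀ u v, Arc19 (σ u) (σ v) ↔ Arc19 u v := by
  induction h using Subgroup.closure_induction with
  | mem x hx =>
    rcases hx with ⟨g, rfl⟩ | rfl
    · intro u v
      simp only [Arc19, Equiv.coe_addRight, ← add_assoc, add_left_inj]
    · decide
  | one => intro u v; rfl
  | mul x y _ _ hx hy => intro u v; rw [Equiv.Perm.mul_apply, Equiv.Perm.mul_apply, hx, hy]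
  | inv x _ hx => intro u v; rw [← hx]; simp

theorem two_comm19 (σ : Equiv.Perm (ZMod 4 × ZMod 2)) (h : σ ∈ Grp19) :
    ∀ u, σ ((2, 0) + u) = (2, 0) + σ u := by
  induction h using Subgroup.closure_induction with
  | mem x hx =>
    rcases hx with ⟨g, rfl⟩ | rfl
    · intro u
      simp only [Equiv.coe_addRight, add_assoc]
    · decide
  | one => intro u; rfl
  | mul x y _ _ hx hy => intro u; rw [Equiv.Perm.mul_apply, Equiv.Perm.mul_apply, hy, hx]
  | inv x _ hx => intro u; rw [Equiv.Perm.inv_eq_iff_eq, hx]; simp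

theorem mem_two19 (w : ZMod 4 × ZMod 2) :
    w ∈ AddSubgroup.zmultiples (((2 : ZMod 4), (0 : ZMod 2))) ↔ w = 0 ∨ w = (2, 0) := by
  constructor
  · intro h
    obtain ⟨k, rfl⟩ := AddSubgroup.mem_zmultiples_iff.1 h
    have e : (2 : ℤ) • (((2 : ZMod 4), (0 : ZMod 2))) = 0 := by decide
    rcases Int.even_or_odd' k with ⟨m, rfl | rfl⟩
    · left; rw [mul_comm, mul_smul, e, smul_zero]
    · right; rw [add_smul, mul_comm, mul_smul, e, smul_zero, zero_add, one_smul]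
  · rintro (rfl | rfl)
    · exact zero_mem _
    · exact AddSubgroup.mem_zmultiples _

theorem coset19 (g : ZMod 4 × ZMod 2) :
    {q : ZMod 4 × ZMod 2 |
        ∃ w ∈ AddSubgroup.zmultiples (((2 : ZMod 4), (0 : ZMod 2))), q = w + g}
      = {g, (2, 0) + g} := by
  ext q
  simp [mem_two19]

theorem arc_out19 (u : ZMod 4 × ZMod 2) : {v | Arc19 u v} = {(1, 0) + u, (1, 1) + u} := rfl

theorem conn_aux19 : ∀ u v : ZMod 4 × ZMod 2,
    Arc19 u v ∨ (Arc19 ((1, 0) + u) v ∨ Arc19 ((2, 0) + u) v) ∨ Arc19 ((3, 0) + u) v := by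
  decide

theorem conn19 (u v : ZMod 4 × ZMod 2) : Relation.EqvGen Arc19 u v := by
  have h1 : ∀ u, Relation.EqvGen Arc19 u ((1, 0) + u) := fun u => .rel _ _ (Or.inl rfl)
  have h2 : ∀ u, Relation.EqvGen Arc19 u ((2, 0) + u) := fun u => by
    have := (h1 u).trans _ _ _ (h1 _)
    rwa [← add_assoc] at this
  have h3 : ∀ u, Relation.EqvGen Arc19 u ((3, 0) + u) := fun u => by
    have := (h1 u).trans _ _ _ (h2 _)
    rwa [← add_assoc] at this
  rcases conn_aux19 u v with h | (h | h) | h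
  · exact .rel _ _ h
  · exact (h1 u).trans _ _ _ (.rel _ _ h)
  · exact (h2 u).trans _ _ _ (.rel _ _ h)
  · exact (h3 u).trans _ _ _ (.rel _ _ h)

theorem arc_trans19 (u v u' v' : ZMod 4 × ZMod 2) (h : Arc19 u v) (h' : Arc19 u' v') :
    ∃ σ ∈ Grp19, σ u = u' ∧ σ v = v' := by
  have e0 : tau19 0 = 0 := by decide
  have e1 : tau19 (1, 0) = (1, 1) := by decide
  have e2 : tau19 (1, 1) = (1, 0) := by decide
  have hA : Equiv.addRight u' * Equiv.addRight (-u) ∈ Grp19 :=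
    mul_mem (trans_mem19 _) (trans_mem19 _)
  have hB : Equiv.addRight u' * (tau19 * Equiv.addRight (-u)) ∈ Grp19 :=
    mul_mem (trans_mem19 _) (mul_mem tau_mem19 (trans_mem19 _))
  rcases h with rfl | rfl <;> rcases h' with rfl | rfl
  · refine ⟨_, hA, ?_, ?_⟩ <;>
      simp only [Equiv.Perm.mul_apply, Equiv.coe_addRight, add_neg_cancel, zero_add,
        add_neg_cancel_right]
  · refine ⟨_, hB, ?_, ?_⟩ <;>
      simp only [Equiv.Perm.mul_apply, Equiv.coe_addRight, add_neg_cancel, zero_add,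
        add_neg_cancel_right, e0, e1]
  · refine ⟨_, hB, ?_, ?_⟩ <;>
      simp only [Equiv.Perm.mul_apply, Equiv.coe_addRight, add_neg_cancel, zero_add,
        add_neg_cancel_right, e0, e2]
  · refine ⟨_, hA, ?_, ?_⟩ <;>
      simp only [Equiv.Perm.mul_apply, Equiv.coe_addRight, add_neg_cancel, zero_add,
        add_neg_cancel_right]

/-- The Cayley digraph on `A = (ℤ/4ℤ) × (ℤ/2ℤ)` with connection set
`{(1,0), (1,1)}` is a connected oriented digraph with 8 vertices and
out-valency 2; the group generated by all translations together with
`τ : (x,y) ↦ (x, y + x mod 2)` preserves its arcs and acts transitively on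
vertices and arcs; and the cosets of the subgroup generated by `(2,0)` form a
system of blocks of imprimitivity of size 2. -/
theorem valency_two_digraph_m_two :
    (∀ u v : ZMod 4 × ZMod 2, Relation.EqvGen Arc19 u v) ∧
    (∀ u v : ZMod 4 × ZMod 2, Arc19 u v → ¬ Arc19 v u) ∧
    Nat.card (ZMod 4 × ZMod 2) = 8 ∧
    (∀ u : ZMod 4 × ZMod 2, {v | Arc19 u v}.ncard = 2) ∧
    (∀ σ ∈ Grp19, ∀ u v : ZMod 4 × ZMod 2, Arc19 u v → Arc19 (σ u) (σ v)) ∧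
    (∀ u v : ZMod 4 × ZMod 2, ∃ σ ∈ Grp19, σ u = v) ∧
    (∀ u v u' v' : ZMod 4 × ZMod 2, Arc19 u v → Arc19 u' v' →
      ∃ σ ∈ Grp19, σ u = u' ∧ σ v = v') ∧
    (∀ g : ZMod 4 × ZMod 2,
      {q : ZMod 4 × ZMod 2 |
        ∃ w ∈ AddSubgroup.zmultiples (((2 : ZMod 4), (0 : ZMod 2))),
          q = w + g}.ncard = 2) ∧
    (∀ σ ∈ Grp19, ∀ g : ZMod 4 × ZMod 2, ∃ g' : ZMod 4 × ZMod 2,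
      σ '' {q : ZMod 4 × ZMod 2 |
          ∃ w ∈ AddSubgroup.zmultiples (((2 : ZMod 4), (0 : ZMod 2))),
            q = w + g} =
        {q : ZMod 4 × ZMod 2 |
          ∃ w ∈ AddSubgroup.zmultiples (((2 : ZMod 4), (0 : ZMod 2))),
            q = w + g'}) := by
  refine ⟨conn19, by decide, by simp, ?_, fun σ h u v => (arc_iff19 σ h u v).2, ?_,
    arc_trans19, ?_, ?_⟩
  · intro u
    rw [arc_out19]
    exact Set.ncard_pair (by revert u; decide)
  · intro u v
    exact ⟨Equiv.addRight (-u + v), trans_mem19 _, by simp⟩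
  · intro g
    rw [coset19]
    exact Set.ncard_pair (by revert g; decide)
  · intro σ h g
    refine ⟨σ g, ?_⟩
    rw [coset19, coset19, Set.image_pair, two_comm19 σ h]
end
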